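/- arXiv:math/0607329 — 6 statements merged into one kernel-verified Lean document; each statement's English description precedes it below -/
import Mathlib

section
/- Let G be a perfect finite simple graph on vertex set X = {x_1,…,x_n} with no isolated vertices and let J = I_c(G) be its ideal of vertex covers. Then G is perfect if and only if the Rees cone of J satisfies ℝ₊(J) = { a = (a_1,…,a_{n+1}) ∈ ℝ^{n+1} : Σ_{x_i∈K} a_i ≥ (|K|−1)·a_{n+1} for every clique K of G }, where the cliques include the empty clique (for which the condition reads a_{n+1} ≥ 0). -/
open Finset

/-- A vertex cover of a graph: a set of vertices meeting every edge. -/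
def IsVCover {n : ℕ} (G : SimpleGraph (Fin n)) (C : Finset (Fin n)) : Prop :=
  ∀ ⦃a b : Fin n⦄, G.Adj a b → a ∈ C ∨ b ∈ C

/-- A minimal vertex cover: no proper subset is a vertex cover. -/
def IsMinVCover {n : ℕ} (G : SimpleGraph (Fin n)) (C : Finset (Fin n)) : Prop :=
  IsVCover G C ∧ ∀ D : Finset (Fin n), D ⊂ C → ¬ IsVCover G D

/-- The clique number of a graph: maximal size of a clique. -/
noncomputable def cliqueNumber {V : Type*} (G : SimpleGraph V) : ℕ :=
  sSup { k : ℕ | ∃ t : Finset V, G.IsNClique k t }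

/-- A graph is perfect if for every induced subgraph the chromatic number
equals the clique number. -/
def IsPerfect {V : Type*} (G : SimpleGraph V) : Prop :=
  ∀ s : Set V, (G.induce s).chromaticNumber = (cliqueNumber (G.induce s) : ℕ∞)

/-- The Rees cone of the ideal of vertex covers `I_c(G)`: all non-negative real
combinations of the unit vectors `e_1,…,e_n` and the vectors `(u_C, 1)` where
`u_C` runs over incidence vectors of minimal vertex covers of `G`. Vectors of
`ℝ^{n+1}` are represented as pairs `(a, a_{n+1}) : (Fin n → ℝ) × ℝ`. -/
def reesCone {n : ℕ} (G : SimpleGraph (Fin n)) : Set ((Fin n → ℝ) × ℝ) :=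
  { v | ∃ (c : Fin n → ℝ) (d : Finset (Fin n) → ℝ),
      (∀ i, 0 ≤ c i) ∧ (∀ C, 0 ≤ d C) ∧
      (∀ C, d C ≠ 0 → IsMinVCover G C) ∧
      (∀ i, v.1 i = c i + ∑ C : Finset (Fin n), d C * (if i ∈ C then 1 else 0)) ∧
      v.2 = ∑ C : Finset (Fin n), d C }

namespace SimpleGraph

variable {n : ℕ} {G : SimpleGraph (Fin n)}

/-- A graph is perfect iff every induced subgraph whose cliques have at most `m` vertices is
`m`-colorable. -/
theorem isPerfect_iff_colorable_induce :
    IsPerfect G ↔ ∀ (s : Set (Fin n)) (m : ℕ),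
      (∀ K : Finset (Fin n), G.IsClique (K : Set (Fin n)) → (K : Set (Fin n)) ⊆ s → #K ≤ m) →
        (G.induce s).Colorable m := by
  classical
  constructor
  · intro h s m hm
    obtain ⟨t, ht⟩ := (G.induce s).exists_isNClique_cliqueNum
    have hcard : (G.induce s).cliqueNum ≤ m := by
      rw [← ht.card_eq, ← Finset.card_map (Function.Embedding.subtype _)]
      refine hm _ ?_ ?_
      · have := ht.isClique
        intro a ha b hb hab
        simp only [Finset.coe_map, Function.Embedding.subtype_apply, Set.mem_image,
          Finset.mem_coe] at ha hb
        obtain ⟨a, ha, rfl⟩ := ha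
        obtain ⟨b, hb, rfl⟩ := hb
        exact this ha hb (fun h => hab (by rw [h]))
      · intro a ha
        simp only [Finset.coe_map, Function.Embedding.subtype_apply, Set.mem_image] at ha
        obtain ⟨a, -, rfl⟩ := ha
        exact a.2
    rw [← chromaticNumber_le_iff_colorable, h s]
    exact_mod_cast hcard
  · intro h s
    refine le_antisymm ?_ (cliqueNum_le_chromaticNumber (G := G.induce s))
    refine chromaticNumber_le_iff_colorable.2 (h s _ fun K hK hKs => ?_)
    have hclique : (G.induce s).IsClique (K.subtype (· ∈ s) : Set s) := by
      intro a ha b hb hab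
      simp only [Finset.mem_coe, Finset.mem_subtype] at ha hb
      exact hK ha hb (fun h => hab (Subtype.ext h))
    have hc := hclique.card_le_cliqueNum
    rwa [Finset.card_subtype, Finset.filter_true_of_mem fun x hx => hKs hx] at hc

/-- A clique and an independent set share at most one vertex. -/
theorem IsClique.sum_ite_mem_le_one {R : Type*} [Ring R] [LinearOrder R]
    [IsStrictOrderedRing R] {K S : Finset (Fin n)} (hK : G.IsClique (K : Set (Fin n)))
    (hS : G.IsIndepSet (S : Set (Fin n))) : ∑ i ∈ K, (if i ∈ S then 1 else 0 : R) ≤ 1 := by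
  rw [Finset.sum_boole]
  have : #{i ∈ K | i ∈ S} ≤ 1 := by
    refine Finset.card_le_one.2 fun a ha b hb => ?_
    simp only [Finset.mem_filter] at ha hb
    by_contra hab
    exact hS ha.2 hb.2 hab (hK ha.1 hb.1 hab)
  exact_mod_cast this

/-- A clique disjoint from some independent set carrying positive weight is not saturated by
the fractional cover `d`. -/
theorem IsClique.sum_cover_lt {R : Type*} [Ring R] [LinearOrder R] [IsStrictOrderedRing R]
    {K S : Finset (Fin n)} {d : Finset (Fin n) → R} (hK : G.IsClique (K : Set (Fin n)))
    (hd : ∀ T, 0 ≤ d T) (hind : ∀ T, d T ≠ 0 → G.IsIndepSet (T : Set (Fin n)))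
    (hS : d S ≠ 0) (hKS : Disjoint K S) :
    ∑ i ∈ K, ∑ T, d T * (if i ∈ T then 1 else 0) < ∑ T, d T := by
  rw [Finset.sum_comm]
  simp_rw [← Finset.mul_sum]
  refine Finset.sum_lt_sum (fun T _ => ?_) ⟨S, Finset.mem_univ _, ?_⟩
  · by_cases hT : d T = 0
    · simp [hT]
    · exact mul_le_of_le_one_right (hd T) (hK.sum_ite_mem_le_one (hind T hT))
  · rw [Finset.sum_eq_zero fun i hi => if_neg (Finset.disjoint_left.1 hKS hi), mul_zero]
    exact lt_of_le_of_ne (hd S) hS.symm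

/-- If `G` is perfect, every integral weight function whose clique weights are at most `m` is
covered by `m` independent sets, counted with multiplicity. -/
theorem exists_cover_of_isPerfect (hG : IsPerfect G) (w : Fin n → ℕ) (m : ℕ)
    (hw : ∀ K : Finset (Fin n), G.IsClique (K : Set (Fin n)) → ∑ i ∈ K, w i ≤ m) :
    ∃ d : Finset (Fin n) → ℕ, (∀ S, d S ≠ 0 → G.IsIndepSet (S : Set (Fin n))) ∧
      ∑ S, d S = m ∧ ∀ i, w i ≤ ∑ S, d S * (if i ∈ S then 1 else 0) := by
  classical
  induction hsum : ∑ i, w i using Nat.strong_induction_on generalizing w m with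
  | _ k ih =>
  subst hsum
  by_cases h1 : ∀ i, w i ≤ 1
  · obtain ⟨col⟩ := isPerfect_iff_colorable_induce.1 hG {i | w i = 1} m fun K hK hKs => by
      have := hw K hK
      rwa [Finset.sum_congr rfl fun i hi => hKs hi, Finset.sum_const, smul_eq_mul,
        mul_one] at this
    let f : Fin m → Finset (Fin n) := fun c => {i | ∃ h : w i = 1, col ⟨i, h⟩ = c}
    have hsumf (g : Finset (Fin n) → ℕ) :
        ∑ S, #{c | f c = S} * g S = ∑ c, g (f c) := by
      rw [← Finset.sum_fiberwise Finset.univ f (fun c => g (f c))]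
      refine Finset.sum_congr rfl fun S _ => ?_
      rw [Finset.sum_congr rfl fun c hc => by rw [(Finset.mem_filter.1 hc).2],
        Finset.sum_const, smul_eq_mul]
    refine ⟨fun S => #{c | f c = S}, fun S hS => ?_, ?_, fun i => ?_⟩
    · obtain ⟨c, hc⟩ := Finset.card_ne_zero.1 hS
      obtain rfl := (Finset.mem_filter.1 hc).2
      intro a ha b hb _ hab
      simp only [f, Finset.coe_filter, Finset.mem_univ, true_and, Set.mem_ofPred_eq] at ha hb
      obtain ⟨ha, hac⟩ := ha
      obtain ⟨hb, hbc⟩ := hb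
      exact col.valid (show (G.induce {i | w i = 1}).Adj ⟨a, ha⟩ ⟨b, hb⟩ from hab)
        (hac.trans hbc.symm)
    · simpa using hsumf fun _ => 1
    · rw [hsumf fun S => if i ∈ S then 1 else 0]
      rcases Nat.le_one_iff_eq_zero_or_eq_one.1 (h1 i) with h | h
      · simp [h]
      · rw [h]
        refine le_trans ?_ (Finset.single_le_sum (fun _ _ => Nat.zero_le _)
          (Finset.mem_univ (col ⟨i, h⟩)))
        simp [f, h]
  · push Not at h1
    obtain ⟨v, hv⟩ := h1
    let w' : Fin n → ℕ := fun i => w i - if i = v then 1 else 0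
    have hw'v : w' v = w v - 1 := by simp [w']
    have hw'w : ∀ i, w' i ≤ w i := fun i => Nat.sub_le _ _
    have hw'lt : ∑ i, w' i < ∑ i, w i :=
      Finset.sum_lt_sum (fun i _ => hw'w i) ⟨v, Finset.mem_univ v, by omega⟩
    obtain ⟨d, hd, hdm, hdw⟩ := ih _ hw'lt w' m
      (fun K hK => (Finset.sum_le_sum fun i _ => hw'w i).trans (hw K hK)) rfl
    obtain ⟨S, hdS, hvS⟩ : ∃ S, d S ≠ 0 ∧ v ∈ S := by
      by_contra! hno
      have h0 : ∑ S, d S * (if v ∈ S then 1 else 0) = 0 := Finset.sum_eq_zero fun S _ => by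
        by_cases hS : d S = 0
        · simp [hS]
        · simp [hno S hS]
      have := hdw v
      omega
    let w'' : Fin n → ℕ := fun i => w' i - if i ∈ S ∧ i ≠ v then 1 else 0
    have hw''w' : ∀ i, w'' i ≤ w' i := fun i => Nat.sub_le _ _
    have hm0 : 0 < m := by
      have := hw {v} (by simp)
      rw [Finset.sum_singleton] at this
      omega
    have hcl : ∀ K : Finset (Fin n), G.IsClique (K : Set (Fin n)) → ∑ i ∈ K, w'' i ≤ m - 1 := by
      intro K hK
      suffices ∑ i ∈ K, w'' i < m by omega
      by_cases hvK : v ∈ K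
      · calc ∑ i ∈ K, w'' i ≤ ∑ i ∈ K, w' i := Finset.sum_le_sum fun i _ => hw''w' i
          _ < ∑ i ∈ K, w i := Finset.sum_lt_sum (fun i _ => hw'w i) ⟨v, hvK, by omega⟩
          _ ≤ m := hw K hK
      by_cases hKS : ∃ i ∈ K, i ∈ S ∧ w' i ≠ 0
      · obtain ⟨i, hiK, hiS, hi⟩ := hKS
        calc ∑ i ∈ K, w'' i < ∑ i ∈ K, w' i := by
              refine Finset.sum_lt_sum (fun i _ => hw''w' i) ⟨i, hiK, ?_⟩
              have : i ≠ v := fun h => hvK (h ▸ hiK)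
              simp only [w'', hiS, this, ne_eq, not_false_eq_true, and_self, if_true]
              omega
          _ ≤ ∑ i ∈ K, w i := Finset.sum_le_sum fun i _ => hw'w i
          _ ≤ m := hw K hK
      · push Not at hKS
        have hK' : G.IsClique ((K \ S : Finset (Fin n)) : Set (Fin n)) :=
          hK.subset (by simp)
        have hlt := hK'.sum_cover_lt (d := fun T => (d T : ℤ)) (S := S) (fun T => by positivity)
          (fun T hT => hd T (by exact_mod_cast hT)) (by exact_mod_cast hdS)
          Finset.sdiff_disjoint
        calc ∑ i ∈ K, w'' i ≤ ∑ i ∈ K, w' i := Finset.sum_le_sum fun i _ => hw''w' i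
          _ = ∑ i ∈ K \ S, w' i := by
              refine (Finset.sum_subset Finset.sdiff_subset fun i hi hi' => hKS i hi ?_).symm
              simpa [hi] using hi'
          _ ≤ ∑ i ∈ K \ S, ∑ T, d T * (if i ∈ T then 1 else 0) :=
              Finset.sum_le_sum fun i _ => hdw i
          _ < ∑ T, d T := by exact_mod_cast hlt
          _ = m := hdm
    obtain ⟨e, he, hem, hew⟩ := ih _
      ((Finset.sum_le_sum fun i _ => hw''w' i).trans_lt hw'lt) w'' (m - 1) hcl rfl
    refine ⟨fun T => e T + if T = S then 1 else 0, fun T hT => ?_, ?_, fun i => ?_⟩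
    · by_cases hTS : T = S
      · exact hTS ▸ hd S hdS
      · exact he T (by simpa [hTS] using hT)
    · rw [Finset.sum_add_distrib, hem, Finset.sum_ite_eq' Finset.univ S]
      simp only [Finset.mem_univ, if_true]
      omega
    · simp only [add_mul, Finset.sum_add_distrib]
      have h2 : ∑ T, (if T = S then 1 else 0) * (if i ∈ T then 1 else 0) =
          if i ∈ S then 1 else 0 := by simp [-mul_ite]
      rw [h2]
      have := hew i
      simp only [w'', w'] at this
      by_cases hiv : i = v
      · subst hiv
        simp only [hvS, ne_eq, not_true_eq_false, and_false, if_true, if_false] at this ⊢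
        omega
      · by_cases hiS : i ∈ S <;> simp [hiv, hiS] at this ⊢ <;> omega

/-- If `G` is perfect, every real weight function whose clique weights are at most `t` is
covered by independent sets of total weight `t`. -/
theorem exists_real_cover_of_isPerfect (hG : IsPerfect G) (b : Fin n → ℝ) (t : ℝ)
    (hb : ∀ K : Finset (Fin n), G.IsClique (K : Set (Fin n)) → ∑ i ∈ K, b i ≤ t) :
    ∃ d : Finset (Fin n) → ℝ, (∀ S, 0 ≤ d S) ∧
      (∀ S, d S ≠ 0 → G.IsIndepSet (S : Set (Fin n))) ∧
      ∑ S, d S = t ∧ ∀ i, b i ≤ ∑ S, d S * (if i ∈ S then 1 else 0) := by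
  classical
  have ht : 0 ≤ t := by simpa using hb ∅ (by simp)
  have happrox (N : ℕ) : ∃ d ∈ Set.Icc (0 : Finset (Fin n) → ℝ) (fun _ => t),
      (∀ S : Finset (Fin n), ¬ G.IsIndepSet (S : Set (Fin n)) → d S = 0) ∧ ∑ S, d S ≤ t ∧
      ∀ i, b i - 1 / ((N : ℝ) + 1) ≤ ∑ S, d S * (if i ∈ S then 1 else 0) := by
    have hN : (0 : ℝ) < N + 1 := by positivity
    obtain ⟨e, he, hem, hew⟩ := exists_cover_of_isPerfect hG
      (fun i => ⌊((N : ℝ) + 1) * b i⌋₊) ⌊((N : ℝ) + 1) * t⌋₊ fun K hK => by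
        refine Nat.le_floor ?_
        have hK' : G.IsClique (({i ∈ K | 0 ≤ b i} : Finset (Fin n)) : Set (Fin n)) :=
          hK.subset (Finset.coe_subset.2 (Finset.filter_subset _ _))
        push_cast
        calc ∑ i ∈ K, (⌊((N : ℝ) + 1) * b i⌋₊ : ℝ)
            ≤ ∑ i ∈ K, if 0 ≤ b i then ((N : ℝ) + 1) * b i else 0 := by
              refine Finset.sum_le_sum fun i _ => ?_
              split_ifs with h
              · exact Nat.floor_le (by positivity)
              · rw [Nat.floor_of_nonpos (by nlinarith)]
                simp
          _ = (N + 1) * ∑ i ∈ K with 0 ≤ b i, b i := by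
              rw [← Finset.sum_filter, Finset.mul_sum]
          _ ≤ (N + 1) * t := by gcongr; exact hb _ hK'
    have hsum : ∑ S, (e S : ℝ) / (N + 1) ≤ t := by
      rw [← Finset.sum_div, div_le_iff₀ hN, mul_comm t]
      calc ∑ S, (e S : ℝ) = (⌊((N : ℝ) + 1) * t⌋₊ : ℝ) := by exact_mod_cast hem
        _ ≤ _ := Nat.floor_le (by positivity)
    refine ⟨fun S => e S / (N + 1), ⟨fun S => ?_, fun S => ?_⟩, fun S hS => ?_, hsum, fun i => ?_⟩
    · change (0 : ℝ) ≤ e S / (N + 1)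
      positivity
    · exact (Finset.single_le_sum (f := fun S => (e S : ℝ) / (N + 1))
        (fun S _ => by positivity) (Finset.mem_univ S)).trans hsum
    · have : e S = 0 := by
        by_contra h
        exact hS (he S h)
      simp [this]
    · have h1 : (⌊((N : ℝ) + 1) * b i⌋₊ : ℝ) ≤ ∑ S, (e S : ℝ) * (if i ∈ S then 1 else 0) := by
        exact_mod_cast hew i
      have h2 := Nat.lt_floor_add_one (((N : ℝ) + 1) * b i)
      simp_rw [div_mul_eq_mul_div]
      rw [← Finset.sum_div, le_div_iff₀ hN, sub_mul, div_mul_cancel₀ _ hN.ne']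
      linarith
  choose d hdmem hdind hdsum hdcov using happrox
  obtain ⟨e, hemem, φ, hφ, hlim⟩ := isCompact_Icc.tendsto_subseq hdmem
  have hlim' (S : Finset (Fin n)) : Filter.Tendsto (fun N => d (φ N) S) Filter.atTop
      (nhds (e S)) := (tendsto_pi_nhds.1 hlim) S
  have hesum : ∑ S, e S ≤ t :=
    le_of_tendsto' (tendsto_finsetSum _ fun S _ => hlim' S) fun N => hdsum (φ N)
  refine ⟨fun S => e S + if S = ∅ then t - ∑ T, e T else 0, fun S => ?_, fun S hS => ?_, ?_,
    fun i => ?_⟩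
  · have : 0 ≤ e S := hemem.1 S
    dsimp only
    split_ifs <;> linarith
  · by_contra hSi
    have hS0 : S ≠ ∅ := by
      rintro rfl
      exact hSi (by simp [SimpleGraph.IsIndepSet])
    have he0 : e S = 0 := tendsto_nhds_unique (hlim' S)
      (by simp [hdind _ S hSi])
    simp [he0, hS0] at hS
  · simp [Finset.sum_add_distrib]
  · have hcov : b i ≤ ∑ S, e S * (if i ∈ S then 1 else 0) := by
      have hl : Filter.Tendsto (fun N => b i - 1 / ((φ N : ℝ) + 1)) Filter.atTop
          (nhds (b i - 0)) :=
        tendsto_const_nhds.sub (tendsto_one_div_add_atTop_nhds_zero_nat.comp hφ.tendsto_atTop)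
      rw [sub_zero] at hl
      exact le_of_tendsto_of_tendsto' hl
        (tendsto_finsetSum _ fun S _ => (hlim' S).mul_const _) fun N => hdcov (φ N) i
    refine hcov.trans (Finset.sum_le_sum fun S _ => ?_)
    by_cases hS : S = ∅
    · simp [hS]
    · simp [hS]

/-- Every vertex cover contains a minimal one. -/
theorem exists_isMinVCover_subset {C : Finset (Fin n)} (hC : IsVCover G C) :
    ∃ D ⊆ C, IsMinVCover G D := by
  obtain ⟨D, hDC, hD⟩ := exists_minimal_le_of_wellFoundedLT (IsVCover G) C hC
  exact ⟨D, hDC, hD.prop, fun E hE hEc => hE.2 (hD.le_of_le hEc hE.1)⟩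

theorem isIndepSet_compl_of_isVCover {C : Finset (Fin n)} (hC : IsVCover G C) :
    G.IsIndepSet ((Cᶜ : Finset (Fin n)) : Set (Fin n)) := by
  intro a ha b hb _ hab
  rcases hC hab with h | h <;> simp_all

theorem isVCover_compl_of_isIndepSet {S : Finset (Fin n)}
    (hS : G.IsIndepSet (S : Set (Fin n))) : IsVCover G Sᶜ := by
  intro a b hab
  by_contra! h
  simp only [Finset.mem_compl, not_not] at h
  exact hS h.1 h.2 hab.ne hab

/-- Membership in the Rees cone is the existence of a fractional cover of `i ↦ t - a i` by
independent sets of total weight `t`. -/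
theorem mem_reesCone_iff (a : Fin n → ℝ) (t : ℝ) :
    (a, t) ∈ reesCone G ↔ ∃ d : Finset (Fin n) → ℝ, (∀ S, 0 ≤ d S) ∧
      (∀ S, d S ≠ 0 → G.IsIndepSet (S : Set (Fin n))) ∧
      ∑ S, d S = t ∧ ∀ i, t - a i ≤ ∑ S, d S * (if i ∈ S then 1 else 0) := by
  classical
  have hcompl (d : Finset (Fin n) → ℝ) (p : Finset (Fin n) → Prop)
      [DecidablePred p] : ∑ S, d S * (if p S then 1 else 0) =
      ∑ S, d S - ∑ S, d S * (if ¬ p S then 1 else 0) := by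
    rw [← Finset.sum_sub_distrib]
    refine Finset.sum_congr rfl fun S _ => ?_
    by_cases h : p S <;> simp [h]
  constructor
  · rintro ⟨c, d, hc, hd, hmin, ha, ht⟩
    dsimp only at ha ht
    refine ⟨fun S => d Sᶜ, fun S => hd _, fun S hS => ?_, ?_, fun i => ?_⟩
    · simpa using isIndepSet_compl_of_isVCover (hmin _ hS).1
    · rw [ht]
      exact Equiv.sum_comp (compl_involutive (α := Finset (Fin n))).toPerm d
    · have h1 : ∑ S : Finset (Fin n), d Sᶜ * (if i ∈ S then 1 else 0) =
          ∑ C, d C * (if ¬ i ∈ C then 1 else 0) := by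
        rw [← Equiv.sum_comp (compl_involutive (α := Finset (Fin n))).toPerm]
        simp
      rw [h1, ha i, ht, hcompl d (i ∈ ·)]
      linarith [hc i]
  · rintro ⟨d, hd, hind, ht, hcov⟩
    have hex (S : Finset (Fin n)) : ∃ C : Finset (Fin n),
        d S ≠ 0 → C ⊆ Sᶜ ∧ IsMinVCover G C := by
      by_cases hS : d S = 0
      · exact ⟨∅, fun h => (h hS).elim⟩
      · obtain ⟨C, hC⟩ := exists_isMinVCover_subset (isVCover_compl_of_isIndepSet (hind S hS))
        exact ⟨C, fun _ => hC⟩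
    choose f hf using hex
    have hsumf (g : Finset (Fin n) → ℝ) :
        ∑ C, (∑ S with f S = C, d S) * g C = ∑ S, d S * g (f S) := by
      rw [← Finset.sum_fiberwise Finset.univ f fun S => d S * g (f S)]
      refine Finset.sum_congr rfl fun C _ => ?_
      rw [Finset.sum_mul]
      exact Finset.sum_congr rfl fun S hS => by rw [(Finset.mem_filter.1 hS).2]
    refine ⟨fun i => a i - ∑ S, d S * (if i ∈ f S then 1 else 0),
      fun C => ∑ S with f S = C, d S, fun i => ?_, fun C => Finset.sum_nonneg fun S _ => hd S,
      fun C hC => ?_, fun i => ?_, ?_⟩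
    · have h1 : ∑ S, d S * (if i ∈ f S then 1 else 0) ≤
          ∑ S, d S * (if ¬ i ∈ S then 1 else 0 : ℝ) := by
        refine Finset.sum_le_sum fun S _ => ?_
        by_cases hS : d S = 0
        · simp [hS]
        refine mul_le_mul_of_nonneg_left ?_ (hd S)
        by_cases hi : i ∈ f S
        · have := (hf S hS).1 hi
          simp_all
        · simp only [hi, if_false]
          split_ifs <;> simp
      have h2 := hcompl d (i ∈ ·)
      have h3 := hcov i
      linarith
    · obtain ⟨S, hS, hS0⟩ := Finset.exists_ne_zero_of_sum_ne_zero hC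
      exact (Finset.mem_filter.1 hS).2 ▸ (hf S hS0).2
    · rw [hsumf fun C => if i ∈ C then 1 else 0]
      ring
    · simpa [ht] using (hsumf fun _ => 1).symm

/-- If every weight function with clique weights at most `t` has a fractional cover of
total weight `t` by independent sets, then `G` is perfect. -/
theorem isPerfect_of_exists_cover
    (h : ∀ (b : Fin n → ℝ) (t : ℝ),
      (∀ K : Finset (Fin n), G.IsClique (K : Set (Fin n)) → ∑ i ∈ K, b i ≤ t) →
      ∃ d : Finset (Fin n) → ℝ, (∀ S, 0 ≤ d S) ∧
        (∀ S, d S ≠ 0 → G.IsIndepSet (S : Set (Fin n))) ∧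
        ∑ S, d S = t ∧ ∀ i, b i ≤ ∑ S, d S * (if i ∈ S then 1 else 0)) :
    IsPerfect G := by
  classical
  refine isPerfect_iff_colorable_induce.2 fun s m => ?_
  induction m generalizing s with
  | zero =>
    intro hs
    have : IsEmpty s := ⟨fun x => by
      have := hs {x.1} (by simp) (by simp)
      simp at this⟩
    exact colorable_zero_iff.2 this
  | succ m ih =>
    intro hs
    obtain ⟨d, hd, hind, hsum, hcov⟩ := h (fun i => if i ∈ s then 1 else 0) (m + 1)
      fun K hK => by
        rw [Finset.sum_boole]
        exact_mod_cast hs {i ∈ K | i ∈ s}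
          (hK.subset (Finset.coe_subset.2 (Finset.filter_subset _ _))) (by intro x; simp)
    obtain ⟨S, -, hS⟩ : ∃ S ∈ Finset.univ, d S ≠ 0 :=
      Finset.exists_ne_zero_of_sum_ne_zero (by rw [hsum]; positivity)
    obtain ⟨col⟩ := ih (s \ S) fun K hK hKs => by
      have hlt := hK.sum_cover_lt hd hind hS
        (Finset.disjoint_left.2 fun i hi => (hKs hi).2)
      have hle : (#K : ℝ) ≤ ∑ i ∈ K, ∑ T, d T * (if i ∈ T then 1 else 0) := by
        rw [Finset.cast_card]
        refine Finset.sum_le_sum fun i hi => ?_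
        simpa [(hKs hi).1] using hcov i
      have : (#K : ℝ) < m + 1 := hle.trans_lt (hsum ▸ hlt)
      exact Nat.lt_succ_iff.1 (by exact_mod_cast this)
    refine ⟨Coloring.mk (fun x => if hx : x.1 ∈ S then Fin.last m else
      (col ⟨x.1, x.2, hx⟩).castSucc) ?_⟩
    rintro ⟨x, hx⟩ ⟨y, hy⟩ hxy
    have hxy' : G.Adj x y := hxy
    by_cases hxS : x ∈ S <;> by_cases hyS : y ∈ S
    · exact (hind S hS hxS hyS hxy'.ne hxy').elim
    · simp [hxS, hyS, (Fin.castSucc_lt_last _).ne']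
    · simp [hxS, hyS, (Fin.castSucc_lt_last _).ne]
    · simp only [hxS, hyS, dif_neg, not_false_eq_true, ne_eq, Fin.castSucc_inj]
      exact col.valid (show (G.induce (s \ S)).Adj ⟨x, hx, hxS⟩ ⟨y, hy, hyS⟩ from hxy')

end SimpleGraph

/-- Let `G` be a finite simple graph on `x_1,…,x_n` with no
isolated vertices and let `J = I_c(G)` be its ideal of vertex covers. Then `G`
is perfect if and only if the Rees cone of `J` is the set of all
`a ∈ ℝ^{n+1}` such that `∑_{x_i ∈ K} a_i ≥ (|K| - 1) · a_{n+1}` for every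
clique `K` of `G` (including the empty clique). -/
theorem perfect_iff_reesCone_eq {n : ℕ} (G : SimpleGraph (Fin n))
    (hiso : ∀ v : Fin n, ∃ w : Fin n, G.Adj v w) :
    IsPerfect G ↔
      reesCone G =
        { a : (Fin n → ℝ) × ℝ |
          ∀ K : Finset (Fin n), G.IsClique (K : Set (Fin n)) →
            ((K.card : ℝ) - 1) * a.2 ≤ ∑ i ∈ K, a.1 i } := by
  have hclique (a : Fin n → ℝ) (t : ℝ) (K : Finset (Fin n)) :
      ((K.card : ℝ) - 1) * t ≤ ∑ i ∈ K, a i ↔ ∑ i ∈ K, (t - a i) ≤ t := by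
    rw [Finset.sum_sub_distrib, Finset.sum_const, nsmul_eq_mul]
    constructor <;> intro h <;> linarith
  constructor
  · intro hG
    ext ⟨a, t⟩
    rw [SimpleGraph.mem_reesCone_iff]
    simp only [Set.mem_ofPred_eq, hclique]
    refine ⟨?_, SimpleGraph.exists_real_cover_of_isPerfect hG _ t⟩
    rintro ⟨d, hd, hind, hsum, hcov⟩ K hK
    calc ∑ i ∈ K, (t - a i) ≤ ∑ i ∈ K, ∑ S, d S * (if i ∈ S then 1 else 0) :=
          Finset.sum_le_sum fun i _ => hcov i
      _ = ∑ S, d S * ∑ i ∈ K, (if i ∈ S then 1 else 0) := by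
          rw [Finset.sum_comm]
          simp_rw [Finset.mul_sum]
      _ ≤ ∑ S, d S := by
          refine Finset.sum_le_sum fun S _ => ?_
          by_cases hS : d S = 0
          · simp [hS]
          · exact mul_le_of_le_one_right (hd S) (hK.sum_ite_mem_le_one (hind S hS))
      _ = t := hsum
  · intro heq
    refine SimpleGraph.isPerfect_of_exists_cover fun b t hb => ?_
    have hmem : ((fun i => t - b i), t) ∈ reesCone G := by
      rw [heq]
      intro K hK
      rw [hclique]
      simpa using hb K hK
    simpa using (SimpleGraph.mem_reesCone_iff _ t).1 hmem
end

section
/- Let G be a perfect finite simple graph on vertex set X = {x_1,…,x_n} with no isolated vertices and let J = I_c(G). For every clique K of G (including the empty clique), the set F = { a ∈ ℝ₊(J) : Σ_{x_i∈K} a_i = (|K|−1)·a_{n+1} } is a facet of the Rees cone ℝ₊(J), i.e., F has dimension n; consequently the representation ℝ₊(J) = ∩_K { a : Σ_{x_i∈K} a_i ≥ (|K|−1)a_{n+1} } over all cliques K of G is the irreducible representation of ℝ₊(J). -/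
open Finset

/-- Every vertex cover contains a minimal one. -/
lemma IsVCover.exists_isMinVCover {n : ℕ} {G : SimpleGraph (Fin n)} {C : Finset (Fin n)}
    (hC : IsVCover G C) : ∃ D ⊆ C, IsMinVCover G D := by
  obtain ⟨D, hDC, hD⟩ := exists_minimal_le_of_wellFoundedLT (IsVCover G) C hC
  exact ⟨D, hDC, hD.prop, fun E hE hE' => hE.2 (hD.le_of_le hE' hE.1)⟩

/-- A vertex cover misses at most one vertex of a clique. -/
lemma IsVCover.card_sub_one_le {n : ℕ} {G : SimpleGraph (Fin n)} {C K : Finset (Fin n)}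
    (hC : IsVCover G C) (hK : G.IsClique (K : Set (Fin n))) :
    (K.card : ℝ) - 1 ≤ ∑ i ∈ K, if i ∈ C then (1 : ℝ) else 0 := by
  have h1 : (K.filter (· ∉ C)).card ≤ 1 := by
    rw [Finset.card_le_one]
    intro a ha b hb
    simp only [Finset.mem_filter] at ha hb
    by_contra hab
    exact (hC (hK ha.1 hb.1 hab)).elim ha.2 hb.2
  have h2 := Finset.card_filter_add_card_filter_not (s := K) (· ∈ C)
  have h3 : (K.card : ℝ) ≤ (K.filter (· ∈ C)).card + 1 := by
    exact_mod_cast (by omega : K.card ≤ (K.filter (· ∈ C)).card + 1)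
  rw [Finset.sum_boole]
  linarith

/-- For a vertex `i`, some minimal vertex cover misses `i`. -/
lemma exists_isMinVCover_notMem {n : ℕ} (G : SimpleGraph (Fin n)) (i : Fin n) :
    ∃ C, IsMinVCover G C ∧ i ∉ C := by
  have h : IsVCover G {i}ᶜ := by
    intro a b hab
    simp only [Finset.mem_compl, Finset.mem_singleton]
    by_contra! hc
    exact hab.ne (hc.1.trans hc.2.symm)
  obtain ⟨C, hC, hmin⟩ := h.exists_isMinVCover
  exact ⟨C, hmin, fun hi => by simpa using hC hi⟩

/-- A stable set meets a clique in at most one vertex. -/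
lemma SimpleGraph.IsClique.sum_boole_isIndepSet_le_one {V : Type*} [DecidableEq V]
    {G : SimpleGraph V} {Q S : Finset V} (hQ : G.IsClique (Q : Set V))
    (hS : G.IsIndepSet (S : Set V)) : ∑ i ∈ Q, (if i ∈ S then 1 else 0) ≤ 1 := by
  rw [← Finset.card_filter, Finset.card_le_one]
  intro a ha b hb
  simp only [Finset.mem_filter] at ha hb
  by_contra hab
  exact hS ha.2 hb.2 hab (hQ ha.1 hb.1 hab)

/-- In a perfect graph, a set of vertices all of whose cliques have at most `k` elements is a
union of `k` stable sets. -/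
lemma IsPerfect.exists_isIndepSet_cover {V : Type*} [Fintype V] {G : SimpleGraph V}
    (hG : IsPerfect G) (s : Finset V) (k : ℕ)
    (hk : ∀ Q ⊆ s, G.IsClique (Q : Set V) → Q.card ≤ k) :
    ∃ f : Fin k → Finset V, (∀ j, G.IsIndepSet (f j : Set V)) ∧ ∀ i ∈ s, ∃ j, i ∈ f j := by
  classical
  have hle : cliqueNumber (G.induce (s : Set V)) ≤ k := by
    refine csSup_le' ?_
    rintro m ⟨t, ht⟩
    have hmap := (ht.map (f := .subtype _)).mono
      (SimpleGraph.map_comap_le (Function.Embedding.subtype _) G)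
    rw [← hmap.card_eq]
    refine hk _ ?_ hmap.isClique
    intro x hx
    obtain ⟨y, -, rfl⟩ := Finset.mem_map.1 hx
    exact y.2
  have hcol : (G.induce (s : Set V)).Colorable k := by
    rw [← SimpleGraph.chromaticNumber_le_iff_colorable, hG]
    exact_mod_cast hle
  obtain ⟨c⟩ := hcol
  refine ⟨fun j => Finset.univ.filter fun i => ∃ h : i ∈ (s : Set V), c ⟨i, h⟩ = j, ?_, ?_⟩
  · intro j a ha b hb _ hadj
    simp only [Finset.coe_filter, Finset.mem_univ, true_and, Set.mem_ofPred_eq] at ha hb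
    obtain ⟨h1, h1'⟩ := ha
    obtain ⟨h2, h2'⟩ := hb
    exact c.valid (v := ⟨a, h1⟩) (w := ⟨b, h2⟩) hadj (h1'.trans h2'.symm)
  · intro i hi
    exact ⟨c ⟨i, hi⟩, by simpa using hi⟩

/-- The replication lemma of Lovász in weighted form: if every clique of a perfect graph has weight at
most `k`, then `k` stable sets cover every vertex at least as often as its weight. -/
lemma IsPerfect.exists_weighted_isIndepSet_cover {V : Type*} [Fintype V] [DecidableEq V]
    {G : SimpleGraph V} (hG : IsPerfect G) (w : V → ℕ) (k : ℕ)
    (hk : ∀ Q : Finset V, G.IsClique (Q : Set V) → ∑ i ∈ Q, w i ≤ k) :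
    ∃ f : Fin k → Finset V, (∀ j, G.IsIndepSet (f j : Set V)) ∧
      ∀ i, w i ≤ ∑ j, if i ∈ f j then 1 else 0 := by
  induction hm : ∑ i, w i using Nat.strong_induction_on generalizing w k with
  | _ m ih =>
  subst hm
  by_cases hw : ∀ i, w i ≤ 1
  · obtain ⟨f, hf, hcov⟩ := hG.exists_isIndepSet_cover (Finset.univ.filter (w · ≠ 0)) k (by
      intro Q hQ hQc
      refine le_trans ?_ (hk Q hQc)
      rw [Finset.card_eq_sum_ones]
      refine Finset.sum_le_sum fun i hi => ?_
      have := (Finset.mem_filter.1 (hQ hi)).2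
      omega)
    refine ⟨f, hf, fun i => ?_⟩
    rcases Nat.eq_zero_or_pos (w i) with h0 | h0
    · simp [h0]
    · obtain ⟨j, hj⟩ := hcov i (by simp; omega)
      refine (hw i).trans ?_
      calc 1 = (if i ∈ f j then 1 else 0) := by simp [hj]
        _ ≤ _ := Finset.single_le_sum (f := fun j => if i ∈ f j then 1 else 0)
          (fun _ _ => Nat.zero_le _) (Finset.mem_univ j)
  · push Not at hw
    obtain ⟨v, hv⟩ := hw
    let u : V → ℕ := fun i => if i = v then w i - 1 else w i
    have huw : ∀ i, u i ≤ w i := fun i => by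
      simp only [u]; split_ifs <;> omega
    have huv : u v + 1 = w v := by simp only [u, if_true]; omega
    have hsum : ∑ i, u i < ∑ i, w i :=
      Finset.sum_lt_sum (fun i _ => huw i) ⟨v, Finset.mem_univ _, by omega⟩
    obtain ⟨f, hf, hcov⟩ := ih _ hsum u k
      (fun Q hQ => (Finset.sum_le_sum fun i _ => huw i).trans (hk Q hQ)) rfl
    obtain ⟨j₀, hj₀⟩ : ∃ j, v ∈ f j := by
      by_contra! hc
      have := hcov v
      simp only [hc, if_false, Finset.sum_const_zero] at this
      omega
    let H : V → ℕ := fun i => u i - if i ∈ f j₀ ∧ i ≠ v then 1 else 0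
    have hHu : ∀ i, H i ≤ u i := fun i => Nat.sub_le _ _
    obtain ⟨k, rfl⟩ : ∃ l, k = l + 1 := Nat.exists_eq_succ_of_ne_zero j₀.pos.ne'
    have hHk : ∀ Q : Finset V, G.IsClique (Q : Set V) → ∑ i ∈ Q, H i ≤ k := by
      intro Q hQ
      by_contra! hlt
      have hHuQ : ∑ i ∈ Q, H i ≤ ∑ i ∈ Q, u i := Finset.sum_le_sum fun i _ => hHu i
      have hvQ : v ∉ Q := by
        intro hvQ
        have : ∑ i ∈ Q, u i < ∑ i ∈ Q, w i :=
          Finset.sum_lt_sum (fun i _ => huw i) ⟨v, hvQ, by omega⟩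
        have := hk Q hQ
        omega
      -- the colour classes other than `f j₀` already cover `H` on `Q`
      have hH : ∀ i ∈ Q, H i ≤ ∑ j ∈ Finset.univ.erase j₀, if i ∈ f j then 1 else 0 := by
        intro i hi
        have hiv : i ≠ v := fun h => hvQ (h ▸ hi)
        have h1 := hcov i
        rw [← Finset.add_sum_erase _ _ (Finset.mem_univ j₀)] at h1
        simp only [H, hiv, ne_eq, not_false_eq_true, and_true]
        omega
      have h2 := Finset.sum_le_sum hH
      rw [Finset.sum_comm] at h2
      have h3 := Finset.sum_le_card_nsmul (Finset.univ.erase j₀)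
        (fun j => ∑ i ∈ Q, if i ∈ f j then 1 else 0) 1
        (fun j _ => hQ.sum_boole_isIndepSet_le_one (hf j))
      simp only [Finset.card_erase_of_mem (Finset.mem_univ j₀), Finset.card_univ,
        Fintype.card_fin, smul_eq_mul, mul_one, Nat.add_sub_cancel] at h3
      omega
    obtain ⟨g, hg, hgcov⟩ := ih _
      ((Finset.sum_le_sum fun i _ => hHu i).trans_lt hsum) H k hHk rfl
    refine ⟨Fin.cons (f j₀) g, ?_, fun i => ?_⟩
    · intro j
      refine Fin.cases ?_ (fun j => ?_) j
      · simpa using hf j₀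
      · simpa using hg j
    · rw [Fin.sum_univ_succ]
      simp only [Fin.cons_zero, Fin.cons_succ]
      have h1 := hgcov i
      by_cases hiv : i = v
      · subst hiv
        simp only [H, ne_eq, not_true_eq_false, and_false, if_false, Nat.sub_zero] at h1
        simp only [hj₀, if_true]
        omega
      · simp only [H, u, hiv, ne_eq, not_false_eq_true, and_true, if_false] at h1
        omega

/-- If every clique of a perfect graph has integral weight at most `k`, then there are `k` minimal
vertex covers such that each vertex is missed at least as often as its weight. -/
lemma IsPerfect.exists_isMinVCover_family {n : ℕ} {G : SimpleGraph (Fin n)} (hG : IsPerfect G)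
    (w : Fin n → ℕ) (k : ℕ)
    (hk : ∀ Q : Finset (Fin n), G.IsClique (Q : Set (Fin n)) → ∑ i ∈ Q, w i ≤ k) :
    ∃ g : Fin k → Finset (Fin n), (∀ j, IsMinVCover G (g j)) ∧
      ∀ i, w i ≤ ∑ j, if i ∈ g j then 0 else 1 := by
  obtain ⟨f, hf, hcov⟩ := hG.exists_weighted_isIndepSet_cover w k hk
  have hcover : ∀ j, ∃ D ⊆ (f j)ᶜ, IsMinVCover G D := by
    refine fun j => IsVCover.exists_isMinVCover fun a b hab => ?_
    simp only [Finset.mem_compl]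
    by_contra! hc
    exact hf j hc.1 hc.2 hab.ne hab
  choose g hgf hg using hcover
  refine ⟨g, hg, fun i => (hcov i).trans (Finset.sum_le_sum fun j _ => ?_)⟩
  by_cases hi : i ∈ f j
  · have : i ∉ g j := fun h => Finset.mem_compl.1 (hgf j h) hi
    simp [this, hi]
  · simp [hi]

/-- If every clique of a perfect graph has real weight at most `1`, then some probability
distribution on minimal vertex covers misses each vertex with probability at least its weight. -/
lemma IsPerfect.exists_fractional_isMinVCover {n : ℕ} {G : SimpleGraph (Fin n)}
    (hG : IsPerfect G) (w : Fin n → ℝ) (hw : ∀ i, 0 ≤ w i)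
    (hk : ∀ Q : Finset (Fin n), G.IsClique (Q : Set (Fin n)) → ∑ i ∈ Q, w i ≤ 1) :
    ∃ p ∈ stdSimplex ℝ (Finset (Fin n)), (∀ C, p C ≠ 0 → IsMinVCover G C) ∧
      ∀ i, w i ≤ ∑ C, p C * if i ∈ C then 0 else 1 := by
  have happrox : ∀ N : ℕ, ∃ p ∈ stdSimplex ℝ (Finset (Fin n)),
      (∀ C, ¬ IsMinVCover G C → p C = 0) ∧
      ∀ i, w i - 1 / ((N : ℝ) + 1) ≤ ∑ C, p C * if i ∈ C then 0 else 1 := by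
    intro N
    have hN : (0 : ℝ) < (N : ℝ) + 1 := by positivity
    obtain ⟨g, hg, hcov⟩ := hG.exists_isMinVCover_family (fun i => ⌊((N : ℝ) + 1) * w i⌋₊) (N + 1)
      (by
        intro Q hQ
        have h : ((∑ i ∈ Q, ⌊((N : ℝ) + 1) * w i⌋₊ : ℕ) : ℝ) ≤ ((N + 1 : ℕ) : ℝ) := by
          push_cast
          calc _ ≤ ∑ i ∈ Q, ((N : ℝ) + 1) * w i :=
                Finset.sum_le_sum fun i _ => Nat.floor_le (mul_nonneg hN.le (hw i))
            _ = ((N : ℝ) + 1) * ∑ i ∈ Q, w i := by rw [Finset.mul_sum]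
            _ ≤ ((N : ℝ) + 1) * 1 := by gcongr; exact hk Q hQ
            _ = _ := mul_one _
        exact_mod_cast h)
    -- the empirical distribution of the family `g`
    let p : Finset (Fin n) → ℝ := fun C => ∑ j, if g j = C then 1 / ((N : ℝ) + 1) else 0
    refine ⟨p, ⟨fun C => Finset.sum_nonneg fun j _ => ?_, ?_⟩, fun C hC => ?_, fun i => ?_⟩
    · split_ifs <;> positivity
    · simp only [p]
      rw [Finset.sum_comm]
      simp only [Finset.sum_ite_eq, Finset.mem_univ, if_true, Finset.sum_const, Finset.card_univ,
        Fintype.card_fin, nsmul_eq_mul]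
      push_cast
      field_simp
    · refine Finset.sum_eq_zero fun j _ => if_neg ?_
      rintro rfl
      exact hC (hg j)
    · have h1 : ∑ C, p C * (if i ∈ C then (0 : ℝ) else 1) =
          (1 / ((N : ℝ) + 1)) * ∑ j, if i ∈ g j then (0 : ℝ) else 1 := by
        simp only [p, Finset.sum_mul]
        rw [Finset.sum_comm, Finset.mul_sum]
        refine Finset.sum_congr rfl fun j _ => ?_
        simp only [ite_mul, zero_mul, Finset.sum_ite_eq, Finset.mem_univ, if_true]
      have h2 : (⌊((N : ℝ) + 1) * w i⌋₊ : ℝ) ≤ ∑ j, if i ∈ g j then (0 : ℝ) else 1 := by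
        exact_mod_cast hcov i
      have h3 := Nat.lt_floor_add_one (((N : ℝ) + 1) * w i)
      rw [h1]
      calc w i - 1 / ((N : ℝ) + 1) = (1 / ((N : ℝ) + 1)) * (((N : ℝ) + 1) * w i - 1) := by
            field_simp
        _ ≤ _ := by gcongr; linarith
  choose p hp hmin hcov using happrox
  obtain ⟨q, hq, φ, hφ, hlim⟩ := (isCompact_stdSimplex ℝ (Finset (Fin n))).tendsto_subseq hp
  have hlimC : ∀ C, Filter.Tendsto (fun N => p (φ N) C) Filter.atTop (nhds (q C)) :=
    fun C => (tendsto_pi_nhds.1 hlim) C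
  refine ⟨q, hq, fun C hC => ?_, fun i => ?_⟩
  · by_contra hnot
    refine hC (tendsto_nhds_unique (hlimC C) ?_)
    simp [fun N => hmin (φ N) C hnot]
  · refine le_of_tendsto_of_tendsto' (f := fun N => w i - 1 / ((φ N : ℝ) + 1)) ?_
      (tendsto_finsetSum _ fun C _ => (hlimC C).mul_const _) fun N => hcov (φ N) i
    simpa using tendsto_const_nhds.sub
      ((tendsto_one_div_add_atTop_nhds_zero_nat (𝕜 := ℝ)).comp hφ.tendsto_atTop)

/-- The Rees cone satisfies the inequality of every clique. -/
lemma clique_le_of_mem_reesCone {n : ℕ} {G : SimpleGraph (Fin n)} {a : (Fin n → ℝ) × ℝ}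
    (ha : a ∈ reesCone G) {K : Finset (Fin n)} (hK : G.IsClique (K : Set (Fin n))) :
    ((K.card : ℝ) - 1) * a.2 ≤ ∑ i ∈ K, a.1 i := by
  obtain ⟨c, d, hc, hd, hmin, h1, h2⟩ := ha
  simp only [h1, h2, Finset.sum_add_distrib]
  rw [Finset.sum_comm, Finset.mul_sum]
  refine le_add_of_nonneg_of_le (Finset.sum_nonneg fun i _ => hc i)
    (Finset.sum_le_sum fun C _ => ?_)
  rw [← Finset.mul_sum, mul_comm]
  by_cases h0 : d C = 0
  · simp [h0]
  · exact mul_le_mul_of_nonneg_left ((hmin C h0).1.card_sub_one_le hK) (hd C)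

/-- For a perfect graph, the clique inequalities cut out the Rees cone. -/
lemma IsPerfect.mem_reesCone {n : ℕ} {G : SimpleGraph (Fin n)} (hG : IsPerfect G)
    {a : (Fin n → ℝ) × ℝ}
    (ha : ∀ K : Finset (Fin n), G.IsClique (K : Set (Fin n)) →
      ((K.card : ℝ) - 1) * a.2 ≤ ∑ i ∈ K, a.1 i) : a ∈ reesCone G := by
  have hi : ∀ i, 0 ≤ a.1 i := fun i => by simpa using ha {i} (by simp)
  have ht : 0 ≤ a.2 := by simpa using ha ∅ (by simp)
  rcases ht.eq_or_lt with ht | ht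
  · exact ⟨a.1, 0, hi, by simp, by simp, by simp, by simp [← ht]⟩
  obtain ⟨p, hp, hmin, hcov⟩ := hG.exists_fractional_isMinVCover
    (fun i => max 0 (1 - a.1 i / a.2)) (fun i => le_max_left _ _) (by
      intro Q hQ
      have hQ' : G.IsClique ((Q.filter fun i => 0 ≤ 1 - a.1 i / a.2 : Finset (Fin n)) :
          Set (Fin n)) := hQ.subset (Finset.coe_subset.2 (Finset.filter_subset _ _))
      have h1 := ha _ hQ'
      have h2 : ∑ i ∈ Q, max 0 (1 - a.1 i / a.2) =
          ∑ i ∈ Q.filter (fun i => 0 ≤ 1 - a.1 i / a.2), (1 - a.1 i / a.2) := by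
        rw [Finset.sum_filter]
        refine Finset.sum_congr rfl fun i _ => ?_
        split_ifs with h
        · exact max_eq_right h
        · exact max_eq_left (not_le.1 h).le
      rw [h2, Finset.sum_sub_distrib, ← Finset.sum_div]
      simp only [Finset.sum_const, nsmul_eq_mul, mul_one]
      have h3 := (le_div_iff₀ ht).2 h1
      linarith)
  have hcov' : ∀ i, a.2 * ∑ C, p C * (if i ∈ C then 1 else 0) ≤ a.1 i := by
    intro i
    have h1 : ∑ C, p C * (if i ∈ C then (1 : ℝ) else 0) + ∑ C, p C * (if i ∈ C then 0 else 1)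
        = 1 := by
      refine Eq.trans ?_ hp.2
      rw [← Finset.sum_add_distrib]
      refine Finset.sum_congr rfl fun C _ => ?_
      split_ifs <;> simp
    have h2 := (le_max_right 0 (1 - a.1 i / a.2)).trans (hcov i)
    rw [mul_comm, ← le_div_iff₀ ht]
    linarith
  refine ⟨fun i => a.1 i - a.2 * ∑ C, p C * (if i ∈ C then 1 else 0), fun C => a.2 * p C,
    fun i => sub_nonneg.2 (hcov' i), fun C => mul_nonneg ht.le (hp.1 C),
    fun C hC => hmin C (right_ne_zero_of_mul hC), fun i => ?_, ?_⟩
  · simp only [mul_assoc, ← Finset.mul_sum]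
    ring
  · rw [← Finset.mul_sum, hp.2, mul_one]

/-- The unit vectors `e_i` lie in the Rees cone. -/
lemma single_mem_reesCone {n : ℕ} (G : SimpleGraph (Fin n)) (i : Fin n) :
    ((Pi.single i 1, 0) : (Fin n → ℝ) × ℝ) ∈ reesCone G :=
  ⟨Pi.single i 1, 0, fun j => by by_cases h : j = i <;> simp [h],
    by simp, by simp, by simp, by simp⟩

/-- The vectors `(u_C, 1)` of minimal vertex covers lie in the Rees cone. -/
lemma IsMinVCover.mem_reesCone {n : ℕ} {G : SimpleGraph (Fin n)} {C : Finset (Fin n)}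
    (hC : IsMinVCover G C) :
    ((fun i => if i ∈ C then 1 else 0, 1) : (Fin n → ℝ) × ℝ) ∈ reesCone G := by
  refine ⟨0, Pi.single C 1, by simp, fun D => ?_, fun D hD => ?_, fun i => ?_, by simp⟩
  · by_cases h : D = C <;> simp [h]
  · by_contra h
    exact hD (Pi.single_eq_of_ne (by rintro rfl; exact h hC) _)
  · simp only [Pi.single_apply, ite_mul, one_mul, zero_mul, Finset.sum_ite_eq', Finset.mem_univ,
      if_true, Pi.zero_apply, zero_add]

/-- The linear form `a ↦ ∑_{i ∈ K} a_i - (|K| - 1) a_{n+1}`. -/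
noncomputable def cliqueForm {n : ℕ} (K : Finset (Fin n)) : Module.Dual ℝ ((Fin n → ℝ) × ℝ) :=
  ∑ i ∈ K, LinearMap.proj i ∘ₗ LinearMap.fst ℝ _ _ - ((K.card : ℝ) - 1) • LinearMap.snd ℝ _ _

lemma cliqueForm_apply {n : ℕ} (K : Finset (Fin n)) (a : (Fin n → ℝ) × ℝ) :
    cliqueForm K a = ∑ i ∈ K, a.1 i - ((K.card : ℝ) - 1) * a.2 := by
  simp [cliqueForm]

lemma cliqueForm_ne_zero {n : ℕ} (K : Finset (Fin n)) : cliqueForm K ≠ 0 := by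
  intro h
  rcases K.eq_empty_or_nonempty with rfl | ⟨i, hi⟩
  · simpa [cliqueForm_apply] using LinearMap.congr_fun h (0, 1)
  · simpa [cliqueForm_apply, hi] using LinearMap.congr_fun h (Pi.single i 1, 0)

/-- The face of the Rees cone defined by a clique spans the hyperplane containing it. -/
lemma span_cliqueFace {n : ℕ} (G : SimpleGraph (Fin n)) {K : Finset (Fin n)}
    (hK : G.IsClique (K : Set (Fin n))) :
    Submodule.span ℝ { a ∈ reesCone G | ∑ i ∈ K, a.1 i = ((K.card : ℝ) - 1) * a.2 } =
      LinearMap.ker (cliqueForm K) := by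
  apply le_antisymm
  · rw [Submodule.span_le]
    rintro a ⟨-, ha⟩
    simp [cliqueForm_apply, ha]
  intro a ha
  rw [LinearMap.mem_ker, cliqueForm_apply, sub_eq_zero] at ha
  choose C hC hiC using exists_isMinVCover_notMem G
  have hKC : ∀ i ∈ K, ∀ j ∈ K, (j ∈ C i ↔ j ≠ i) := by
    refine fun i hi j hj => ⟨fun h hji => hiC i (hji ▸ h), fun hne => ?_⟩
    exact ((hC i).1 (hK hj hi hne)).resolve_right (hiC i)
  have hdecomp : a = ∑ i ∈ K, (a.2 - a.1 i) • ((fun j => if j ∈ C i then 1 else 0, 1) :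
        (Fin n → ℝ) × ℝ) +
      ∑ j ∈ Kᶜ, (a.1 j - ∑ i ∈ K, (a.2 - a.1 i) * if j ∈ C i then 1 else 0) •
        ((Pi.single j 1, 0) : (Fin n → ℝ) × ℝ) := by
    have hsum : ∑ i ∈ K, (a.2 - a.1 i) = a.2 := by
      rw [Finset.sum_sub_distrib, ha, Finset.sum_const, nsmul_eq_mul]
      ring
    refine Prod.ext (funext fun j => ?_) ?_
    · simp only [Prod.fst_add, Prod.fst_sum, Prod.smul_fst, Pi.add_apply, Finset.sum_apply,
        Pi.smul_apply, smul_eq_mul, Pi.single_apply]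
      by_cases hj : j ∈ K
      · have h1 : ∑ i ∈ K, (a.2 - a.1 i) * (if j ∈ C i then (1 : ℝ) else 0) =
            ∑ i ∈ K, ((a.2 - a.1 i) - if j = i then a.2 - a.1 i else 0) := by
          refine Finset.sum_congr rfl fun i hi => ?_
          by_cases hji : j = i <;> simp [hKC i hi j hj, hji, hiC]
        rw [h1, Finset.sum_sub_distrib, hsum]
        simp [hj]
      · simp [hj]
    · simp [Prod.snd_sum, hsum]
  rw [hdecomp]
  refine add_mem (sum_mem fun i hi => Submodule.smul_mem _ _ (Submodule.subset_span
    ⟨(hC i).mem_reesCone, ?_⟩)) (sum_mem fun j hj => Submodule.smul_mem _ _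
    (Submodule.subset_span ⟨single_mem_reesCone G j, ?_⟩))
  · have h1 : ∑ j ∈ K, (if j ∈ C i then (1 : ℝ) else 0) =
        ∑ j ∈ K, (1 - if j = i then 1 else 0) := by
      refine Finset.sum_congr rfl fun j hj => ?_
      by_cases hji : j = i <;> simp [hKC i hi j hj, hji, hiC]
    simp only [h1, Finset.sum_sub_distrib]
    simp [hi]
  · simp [Finset.mem_compl.1 hj]

/-- For a perfect graph `G` with no isolated vertices and
`J = I_c(G)`, for every clique `K` of `G` (including the empty clique) the set
`F = { a ∈ ℝ₊(J) : ∑_{x_i∈K} a_i = (|K|-1)·a_{n+1} }` is a facet of the Rees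
cone, i.e. has dimension `n`; consequently
`ℝ₊(J) = ∩_K { a : ∑_{x_i∈K} a_i ≥ (|K|-1) a_{n+1} }` (over all cliques `K`)
is the irreducible representation of `ℝ₊(J)`. -/
theorem reesCone_facets_of_perfect {n : ℕ} (G : SimpleGraph (Fin n))
    (hiso : ∀ v : Fin n, ∃ w : Fin n, G.Adj v w)
    (hperf : IsPerfect G) :
    (∀ K : Finset (Fin n), G.IsClique (K : Set (Fin n)) →
      Module.finrank ℝ (Submodule.span ℝ
        { a ∈ reesCone G | ∑ i ∈ K, a.1 i = ((K.card : ℝ) - 1) * a.2 }) = n) ∧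
    reesCone G =
      { a : (Fin n → ℝ) × ℝ |
        ∀ K : Finset (Fin n), G.IsClique (K : Set (Fin n)) →
          ((K.card : ℝ) - 1) * a.2 ≤ ∑ i ∈ K, a.1 i } := by
  refine ⟨fun K hK => ?_, Set.ext fun a =>
    ⟨fun ha K hK => clique_le_of_mem_reesCone ha hK, fun ha => hperf.mem_reesCone ha⟩⟩
  rw [span_cliqueFace G hK]
  have h := Module.Dual.finrank_ker_add_one_of_ne_zero (cliqueForm_ne_zero K)
  simpa using h
end

section
/- Let G be a perfect finite simple graph on vertex set X = {x_1,…,x_n} with no isolated vertices, let G' be its complement, and let J' = I_c(G'). Then ℝ₊(J') = { a = (a_1,…,a_{n+1}) ∈ ℝ^{n+1} : Σ_{x_i∈S} a_i ≥ (|S|−1)·a_{n+1} for every independent set S of G }, where S ranges over all independent sets of G including the empty set. -/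
open Finset

/-- An independent set of `G`: no two of its vertices are adjacent. -/
def IsIndepSet {n : ℕ} (G : SimpleGraph (Fin n)) (S : Finset (Fin n)) : Prop :=
  ∀ ⦃a⦄, a ∈ S → ∀ ⦃b⦄, b ∈ S → ¬ G.Adj a b

theorem IsVCover.exists_isMinVCover_subset {n : ℕ} {G : SimpleGraph (Fin n)}
    {D : Finset (Fin n)} (hD : IsVCover G D) : ∃ C, C ⊆ D ∧ IsMinVCover G C := by
  induction D using Finset.strongInduction with
  | H D ih =>
    by_cases h : ∃ E, E ⊂ D ∧ IsVCover G E
    · obtain ⟨E, hED, hE⟩ := h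
      obtain ⟨C, hCE, hC⟩ := ih E hED hE
      exact ⟨C, hCE.trans hED.subset, hC⟩
    · push Not at h
      exact ⟨D, Subset.rfl, hD, h⟩

theorem isVCover_compl_of_isClique {n : ℕ} {G : SimpleGraph (Fin n)} {K : Finset (Fin n)}
    (hK : G.IsClique (K : Set (Fin n))) : IsVCover Gᶜ Kᶜ := by
  intro a b hab
  by_contra! h
  rw [Finset.mem_compl, Finset.mem_compl, not_not, not_not] at h
  exact hab.2 (hK h.1 h.2 hab.1)

theorem IsIndepSet.mono {n : ℕ} {G : SimpleGraph (Fin n)} {S T : Finset (Fin n)}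
    (hT : IsIndepSet G T) (h : S ⊆ T) : IsIndepSet G S :=
  fun _ ha _ hb => hT (h ha) (h hb)

theorem IsIndepSet.card_inter_le_one {n : ℕ} {G : SimpleGraph (Fin n)} {S K : Finset (Fin n)}
    (hS : IsIndepSet G S) (hK : G.IsClique (K : Set (Fin n))) : (K ∩ S).card ≤ 1 := by
  rw [Finset.card_le_one]
  intro a ha b hb
  rw [Finset.mem_inter] at ha hb
  by_contra hab
  exact hS ha.2 hb.2 (hK ha.1 hb.1 hab)

/-- A perfect graph whose induced subgraph on `s` has only cliques of size at most `N` admits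
an `N`-colouring of `s`. -/
theorem IsPerfect.colorable_induce {n : ℕ} {G : SimpleGraph (Fin n)} (hG : IsPerfect G)
    (s : Finset (Fin n)) (N : ℕ)
    (hN : ∀ K : Finset (Fin n), G.IsClique (K : Set (Fin n)) → K ⊆ s → K.card ≤ N) :
    (G.induce (s : Set (Fin n))).Colorable N := by
  rw [← SimpleGraph.chromaticNumber_le_iff_colorable, hG, Nat.cast_le]
  refine csSup_le' ?_
  rintro k ⟨t, ht⟩
  rw [← ht.card_eq, ← Finset.card_map (Function.Embedding.subtype _)]
  refine hN _ ?_ ?_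
  · intro a ha b hb hab
    simp only [Finset.coe_map, Set.mem_image, Finset.mem_coe] at ha hb
    obtain ⟨a, ha, rfl⟩ := ha
    obtain ⟨b, hb, rfl⟩ := hb
    exact ht.isClique ha hb (fun h => hab (by rw [h]))
  · intro a ha
    simp only [Finset.mem_map] at ha
    obtain ⟨a, -, rfl⟩ := ha
    exact a.2

/-- Weighted form of the replication lemma: in a perfect graph, if every clique has weight at
most `N`, then `N` independent sets cover every vertex `i` at least `y i` times. -/
theorem IsPerfect.exists_indepSet_cover {n : ℕ} {G : SimpleGraph (Fin n)} (hG : IsPerfect G)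
    (y : Fin n → ℕ) (N : ℕ)
    (hN : ∀ K : Finset (Fin n), G.IsClique (K : Set (Fin n)) → ∑ i ∈ K, y i ≤ N) :
    ∃ f : Fin N → Finset (Fin n), (∀ j, IsIndepSet G (f j)) ∧
      ∀ i, y i ≤ ∑ j, if i ∈ f j then 1 else 0 := by
  induction hm : ∑ i, y i using Nat.strong_induction_on generalizing y N with
  | _ m ih =>
  by_cases hy : ∀ i, y i ≤ 1
  · obtain ⟨c⟩ := hG.colorable_induce {i | y i ≠ 0} N (by
      intro K hK hKs
      refine le_trans ?_ (hN K hK)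
      rw [Finset.card_eq_sum_ones]
      refine Finset.sum_le_sum fun i hi => ?_
      have := (Finset.mem_filter.1 (hKs hi)).2
      omega)
    classical
    refine ⟨fun j => {i | ∃ h : y i ≠ 0, c ⟨i, by simpa using h⟩ = j}, ?_, ?_⟩
    · intro j a ha b hb hab
      obtain ⟨ha', ha⟩ := (Finset.mem_filter.1 ha).2
      obtain ⟨hb', hb⟩ := (Finset.mem_filter.1 hb).2
      exact c.valid (v := ⟨a, by simpa using ha'⟩) (w := ⟨b, by simpa using hb'⟩) hab
        (ha.trans hb.symm)
    · intro i
      by_cases h : y i = 0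
      · simp [h]
      · refine (hy i).trans ?_
        refine le_trans ?_ (Finset.single_le_sum (fun _ _ => Nat.zero_le _)
          (Finset.mem_univ (c ⟨i, by simpa using h⟩)))
        simp [h]
  · push Not at hy
    obtain ⟨x, hx⟩ := hy
    set y' : Fin n → ℕ := fun i => y i - if i = x then 1 else 0 with hy'
    have hle : ∀ i, y' i ≤ y i := fun i => Nat.sub_le _ _
    have hlt : ∑ i, y' i < m := by
      rw [← hm]
      refine Finset.sum_lt_sum (fun i _ => hle i) ⟨x, Finset.mem_univ x, ?_⟩
      simp only [hy', if_true]
      omega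
    obtain ⟨f, hf, hcov⟩ := ih _ hlt y' N
      (fun K hK => (Finset.sum_le_sum fun i _ => hle i).trans (hN K hK)) rfl
    obtain ⟨j, hj⟩ : ∃ j, x ∈ f j := by
      by_contra! h
      have := hcov x
      simp only [h, hy', if_true, if_false, Finset.sum_const_zero] at this
      omega
    set y'' : Fin n → ℕ := fun i => y' i - if i ∈ (f j).erase x then 1 else 0 with hy''
    have hle' : ∀ i, y'' i ≤ y' i := fun i => Nat.sub_le _ _
    obtain ⟨M, rfl⟩ : ∃ M, N = M + 1 := Nat.exists_eq_succ_of_ne_zero (by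
      rintro rfl
      exact j.elim0)
    have hM : ∀ K : Finset (Fin n), G.IsClique (K : Set (Fin n)) → ∑ i ∈ K, y'' i ≤ M := by
      intro K hK
      by_contra! hlarge
      have htight : M + 1 ≤ ∑ i ∈ K, y' i :=
        hlarge.trans_le (Finset.sum_le_sum fun i _ => hle' i)
      have hxK : x ∉ K := by
        intro hxK
        have : ∑ i ∈ K, y' i < ∑ i ∈ K, y i := by
          refine Finset.sum_lt_sum (fun i _ => hle i) ⟨x, hxK, ?_⟩
          simp only [hy', if_true]
          omega
        have := hN K hK
        omega
      have hmeet : ∃ i ∈ K, y' i ≠ 0 ∧ i ∈ f j := by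
        by_contra! hnone
        have hKpos : G.IsClique ((K.filter fun i => y' i ≠ 0 : Finset (Fin n)) : Set (Fin n)) :=
          hK.subset (Finset.coe_subset.2 (Finset.filter_subset _ _))
        have h₁ : ∑ i ∈ K, y' i ≤
            ∑ k, ((K.filter fun i => y' i ≠ 0) ∩ f k).card := by
          rw [← Finset.sum_filter_ne_zero]
          refine (Finset.sum_le_sum fun i _ => hcov i).trans ?_
          rw [Finset.sum_comm]
          refine Finset.sum_le_sum fun k _ => ?_
          rw [Finset.sum_boole, Finset.filter_mem_eq_inter]
          rfl
        have h₂ : ∑ k, ((K.filter fun i => y' i ≠ 0) ∩ f k).card < ∑ _k : Fin (M + 1), 1 := by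
          refine Finset.sum_lt_sum (fun k _ => (hf k).card_inter_le_one hKpos)
            ⟨j, Finset.mem_univ j, ?_⟩
          rw [Nat.lt_one_iff, Finset.card_eq_zero, Finset.eq_empty_iff_forall_notMem]
          intro i hi
          rw [Finset.mem_inter, Finset.mem_filter] at hi
          exact hnone i hi.1.1 hi.1.2 hi.2
        simp only [Finset.sum_const, Finset.card_univ, Fintype.card_fin, smul_eq_mul,
          mul_one] at h₂
        omega
      obtain ⟨i, hiK, hi0, hij⟩ := hmeet
      have hix : i ∈ (f j).erase x := Finset.mem_erase.2 ⟨fun h => hxK (h ▸ hiK), hij⟩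
      have h₁ : ∑ i ∈ K, y'' i < ∑ i ∈ K, y' i := by
        refine Finset.sum_lt_sum (fun i _ => hle' i) ⟨i, hiK, ?_⟩
        simp only [hy'', hix, if_true]
        omega
      have h₂ : ∑ i ∈ K, y' i ≤ ∑ i ∈ K, y i := Finset.sum_le_sum fun i _ => hle i
      have := hN K hK
      omega
    obtain ⟨g, hg, hgcov⟩ := ih _ ((Finset.sum_le_sum fun i _ => hle' i).trans_lt hlt) y'' M hM rfl
    refine ⟨Fin.cons (f j) g, ?_, ?_⟩
    · intro k
      refine Fin.cases ?_ (fun k => ?_) k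
      · simpa using hf j
      · simpa using hg k
    · intro i
      rw [Fin.sum_univ_succ]
      simp only [Fin.cons_zero, Fin.cons_succ]
      have := hgcov i
      simp only [hy'', hy', Finset.mem_erase] at this
      by_cases hi : i = x
      · subst hi
        simp only [hj, if_true, ne_eq, not_true_eq_false, false_and, if_false] at this ⊢
        omega
      · simp only [hi, if_false, ne_eq, not_false_eq_true, true_and] at this
        omega

/-- In a perfect graph, if every independent set has `w`-weight at most `1` and every clique has
`g`-weight at most `U`, then the pairing of `g` and `w` is at most `U`. -/
theorem IsPerfect.sum_mul_le {n : ℕ} {G : SimpleGraph (Fin n)} (hG : IsPerfect G)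
    {w g : Fin n → ℝ} {U : ℝ} (hg : ∀ i, 0 ≤ g i)
    (hw : ∀ S, IsIndepSet G S → ∑ i ∈ S, w i ≤ 1)
    (hU : ∀ K : Finset (Fin n), G.IsClique (K : Set (Fin n)) → ∑ i ∈ K, g i ≤ U) :
    ∑ i, g i * w i ≤ U := by
  have hU0 : 0 ≤ U := by simpa using hU ∅ (by simp)
  have hw' : ∀ S, IsIndepSet G S → ∑ i ∈ S, max (w i) 0 ≤ 1 := by
    intro S hS
    refine le_trans (le_of_eq ?_) (hw (S.filter fun i => 0 ≤ w i) (hS.mono (S.filter_subset _)))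
    rw [Finset.sum_filter]
    refine Finset.sum_congr rfl fun i _ => ?_
    split_ifs with h
    · exact max_eq_left h
    · exact max_eq_right (not_le.1 h).le
  have key : ∀ M : ℕ, M * ∑ i, g i * w i ≤ M * U + (n + 1) := by
    intro M
    have hMU : 0 ≤ M * U + n := by positivity
    obtain ⟨f, hf, hcov⟩ := hG.exists_indepSet_cover (fun i => ⌈M * g i⌉₊) ⌈M * U + n⌉₊ (by
      intro K hK
      rw [← Nat.cast_le (α := ℝ), Nat.cast_sum]
      refine le_trans ?_ (Nat.le_ceil _)
      calc ∑ i ∈ K, (⌈M * g i⌉₊ : ℝ) ≤ ∑ i ∈ K, (M * g i + 1) :=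
            Finset.sum_le_sum fun i _ =>
              (Nat.ceil_lt_add_one (mul_nonneg M.cast_nonneg (hg i))).le
        _ = M * ∑ i ∈ K, g i + K.card := by
            rw [Finset.sum_add_distrib, ← Finset.mul_sum]
            simp
        _ ≤ M * U + n := by
            have : K.card ≤ n := by simpa using K.card_le_univ
            have := hU K hK
            gcongr)
    calc M * ∑ i, g i * w i = ∑ i, M * g i * w i := by
          rw [Finset.mul_sum]
          exact Finset.sum_congr rfl fun i _ => (mul_assoc _ _ _).symm
      _ ≤ ∑ i, (∑ j, if i ∈ f j then (1 : ℝ) else 0) * max (w i) 0 := by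
          refine Finset.sum_le_sum fun i _ => ?_
          refine mul_le_mul_of_nonneg (le_trans (Nat.le_ceil _) ?_) (le_max_left _ _)
            (mul_nonneg M.cast_nonneg (hg i)) (le_max_right _ _)
          exact_mod_cast hcov i
      _ = ∑ j, ∑ i ∈ f j, max (w i) 0 := by
          simp_rw [Finset.sum_mul]
          rw [Finset.sum_comm]
          refine Finset.sum_congr rfl fun j _ => ?_
          simp
      _ ≤ ∑ _j : Fin ⌈M * U + n⌉₊, 1 := Finset.sum_le_sum fun j _ => hw' _ (hf j)
      _ = ⌈M * U + n⌉₊ := by simp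
      _ ≤ M * U + (n + 1) := by linarith [Nat.ceil_lt_add_one hMU]
  by_contra! h
  obtain ⟨M, hM⟩ := exists_nat_gt ((n + 1) / (∑ i, g i * w i - U))
  rw [div_lt_iff₀ (sub_pos.2 h)] at hM
  linarith [key M]

theorem card_sub_one_mul_le_sum_of_mem_reesCone {n : ℕ} {G : SimpleGraph (Fin n)} {a : (Fin n → ℝ) × ℝ}
    (ha : a ∈ reesCone Gᶜ) {S : Finset (Fin n)} (hS : IsIndepSet G S) :
    ((S.card : ℝ) - 1) * a.2 ≤ ∑ i ∈ S, a.1 i := by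
  obtain ⟨c, d, hc, hd, hdC, ha₁, ha₂⟩ := ha
  calc ((S.card : ℝ) - 1) * a.2 = ∑ C, d C * ((S.card : ℝ) - 1) := by
        rw [ha₂, mul_comm, Finset.sum_mul]
    _ ≤ ∑ C, d C * ∑ i ∈ S, if i ∈ C then 1 else 0 := by
        refine Finset.sum_le_sum fun C _ => ?_
        by_cases h : d C = 0
        · simp [h]
        refine mul_le_mul_of_nonneg_left ?_ (hd C)
        have hsdiff : (S \ C).card ≤ 1 := by
          rw [Finset.card_le_one]
          intro x hx y hy
          rw [Finset.mem_sdiff] at hx hy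
          by_contra hxy
          have hadj : Gᶜ.Adj x y := (SimpleGraph.compl_adj ..).2 ⟨hxy, hS hx.1 hy.1⟩
          exact ((hdC C h).1 hadj).elim hx.2 hy.2
        have hcard := Finset.card_inter_add_card_sdiff S C
        rw [Finset.sum_boole, Finset.filter_mem_eq_inter, sub_le_iff_le_add]
        exact_mod_cast (by omega : S.card ≤ (S ∩ C).card + 1)
    _ = ∑ i ∈ S, ∑ C, d C * (if i ∈ C then 1 else 0) := by
        rw [Finset.sum_comm]
        simp_rw [Finset.mul_sum]
    _ ≤ ∑ i ∈ S, a.1 i :=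
        Finset.sum_le_sum fun i _ => by linarith [ha₁ i, hc i]

/-- In a perfect graph, a vector satisfying the independent set inequalities at height `1`
dominates a convex combination of incidence vectors of minimal vertex covers of the complement. -/
theorem IsPerfect.exists_convex_combination_le {n : ℕ} {G : SimpleGraph (Fin n)}
    (hG : IsPerfect G) {a : Fin n → ℝ}
    (ha : ∀ S, IsIndepSet G S → (S.card : ℝ) - 1 ≤ ∑ i ∈ S, a i) :
    ∃ d ∈ stdSimplex ℝ (Finset (Fin n)), (∀ C, ¬ IsMinVCover Gᶜ C → d C = 0) ∧
      ∀ i, ∑ C, d C * (if i ∈ C then 1 else 0) ≤ a i := by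
  let P : Set (Finset (Fin n) → ℝ) :=
    stdSimplex ℝ (Finset (Fin n)) ∩ {d | ∀ C, ¬ IsMinVCover Gᶜ C → d C = 0}
  let L : (Finset (Fin n) → ℝ) →ₗ[ℝ] (Fin n → ℝ) :=
    LinearMap.pi fun i => ∑ C : Finset (Fin n), (if i ∈ C then (1 : ℝ) else 0) • LinearMap.proj C
  have hL : ∀ d i, L d i = ∑ C, d C * (if i ∈ C then 1 else 0) := by
    intro d i
    simp only [L, LinearMap.pi_apply, LinearMap.sum_apply, LinearMap.smul_apply,
      LinearMap.proj_apply, smul_eq_mul, mul_comm]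
  have hPcomp : IsCompact (L '' P) := by
    refine ((isCompact_stdSimplex ℝ _).inter_right ?_).image L.continuous_of_finiteDimensional
    simp only [Set.ofPred_forall]
    exact isClosed_iInter fun C => isClosed_iInter fun _ =>
      isClosed_eq (continuous_apply C) continuous_const
  have hPconv : Convex ℝ (L '' P) := by
    refine ((convex_stdSimplex ℝ _).inter ?_).linear_image L
    intro d hd e he r s _ _ _ C hC
    simp [hd C hC, he C hC]
  by_cases hdisj : Disjoint (Set.Iic a) (L '' P)
  · exfalso
    obtain ⟨φ, u, v, hφa, huv, hφP⟩ :=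
      geometric_hahn_banach_closed_compact (convex_Iic a) isClosed_Iic hPconv hPcomp hdisj
    let g : Fin n → ℝ := fun i => φ (Pi.single i 1)
    have hφ : ∀ z, φ z = ∑ i, g i * z i := by
      intro z
      conv_lhs => rw [pi_eq_sum_univ' z]
      simp [g, map_sum, mul_comm]
    have hg : ∀ i, 0 ≤ g i := by
      intro i
      by_contra! hi
      obtain ⟨M, hM⟩ := exists_nat_gt ((u - φ a) / (- g i))
      rw [div_lt_iff₀ (neg_pos.2 hi)] at hM
      have := hφa (a - (M : ℝ) • Pi.single i 1) (by
        rw [Set.mem_Iic, sub_le_self_iff]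
        exact smul_nonneg M.cast_nonneg (Pi.single_nonneg.2 zero_le_one))
      rw [map_sub, map_smul, smul_eq_mul] at this
      change φ a - M * g i < u at this
      linarith
    have hclique : ∀ K : Finset (Fin n), G.IsClique (K : Set (Fin n)) →
        ∑ i ∈ K, g i ≤ ∑ i, g i - v := by
      intro K hK
      obtain ⟨C, hCK, hC⟩ := (isVCover_compl_of_isClique hK).exists_isMinVCover_subset
      have hmem : Pi.single C (1 : ℝ) ∈ P := by
        refine ⟨single_mem_stdSimplex ℝ C, fun D hD => ?_⟩
        exact Pi.single_eq_of_ne (fun h : D = C => hD (h ▸ hC)) _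
      have h := hφP _ ⟨_, hmem, rfl⟩
      rw [hφ] at h
      have hLC : ∀ i, L (Pi.single C 1) i = if i ∈ C then 1 else 0 := by
        intro i
        rw [hL, Finset.sum_eq_single C] <;> simp +contextual
      simp only [hLC, mul_ite, mul_one, mul_zero, Finset.sum_ite_mem, Finset.univ_inter] at h
      have h₁ : ∑ i ∈ C, g i ≤ ∑ i ∈ Kᶜ, g i :=
        Finset.sum_le_sum_of_subset_of_nonneg hCK fun i _ _ => hg i
      linarith [Finset.sum_add_sum_compl K g]
    have := hG.sum_mul_le (w := fun i => 1 - a i) hg (fun S hS => by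
      have := ha S hS
      simp only [Finset.sum_sub_distrib, Finset.sum_const, nsmul_eq_mul, mul_one]
      linarith) hclique
    simp only [mul_sub, mul_one, Finset.sum_sub_distrib, ← hφ] at this
    linarith [hφa a Set.self_mem_Iic]
  · obtain ⟨_, hle, d, ⟨hd, hd0⟩, rfl⟩ := Set.not_disjoint_iff.1 hdisj
    exact ⟨d, hd, hd0, fun i => hL d i ▸ hle i⟩

/-- Let `G` be a perfect graph on `x_1,…,x_n` with no isolated
vertices, `G'` its complement and `J' = I_c(G')`. Then `ℝ₊(J')` is the set of
`a ∈ ℝ^{n+1}` with `∑_{x_i∈S} a_i ≥ (|S|-1)·a_{n+1}` for every independent set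
`S` of `G` (including the empty set). -/
theorem reesCone_compl_eq_of_perfect {n : ℕ} (G : SimpleGraph (Fin n))
    (hiso : ∀ v : Fin n, ∃ w : Fin n, G.Adj v w)
    (hperf : IsPerfect G) :
    reesCone Gᶜ =
      { a : (Fin n → ℝ) × ℝ |
        ∀ S : Finset (Fin n), IsIndepSet G S →
          ((S.card : ℝ) - 1) * a.2 ≤ ∑ i ∈ S, a.1 i } := by
  ext ⟨a, t⟩
  refine ⟨fun h S hS => card_sub_one_mul_le_sum_of_mem_reesCone h hS, fun h => ?_⟩
  simp only [Set.mem_ofPred_eq] at h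
  have ht : 0 ≤ t := by
    simpa using h ∅ (by simp [IsIndepSet])
  rcases ht.eq_or_lt with rfl | ht
  · refine ⟨a, 0, fun i => ?_, by simp, by simp, by simp, by simp⟩
    simpa using h {i} (by simp [IsIndepSet])
  obtain ⟨d, ⟨hd, hd1⟩, hdC, hda⟩ := hperf.exists_convex_combination_le (a := fun i => a i / t) (by
    intro S hS
    rw [← Finset.sum_div, le_div_iff₀ ht]
    exact h S hS)
  have hscale : ∀ i, ∑ C, t * d C * (if i ∈ C then 1 else 0) =
      t * ∑ C, d C * (if i ∈ C then 1 else 0) := by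
    intro i
    simp_rw [Finset.mul_sum, mul_assoc]
  refine ⟨fun i => a i - ∑ C, t * d C * (if i ∈ C then 1 else 0), fun C => t * d C,
    fun i => ?_, fun C => mul_nonneg ht.le (hd C), fun C hC => ?_, fun i => by simp, ?_⟩
  · beta_reduce
    rw [hscale, sub_nonneg, ← le_div_iff₀' ht]
    exact hda i
  · by_contra hmin
    exact hC (mul_eq_zero_of_right t (hdC C hmin))
  · rw [← Finset.mul_sum, hd1, mul_one]
end

section
/- Let A be an n×q matrix with entries in ℕ and column vectors v_1,…,v_q. Then the linear system x ≥ 0, xA ≤ 𝟙 is totally dual integral if and only if both of the following hold: (i) the polyhedron { x ∈ ℝ^n : x ≥ 0, xA ≤ 𝟙 } is integral (all of its vertices have integer coordinates); and (ii) ℝ₊B ∩ ℤ^{n+1} = ℕB, where B = {(v_1,1),…,(v_q,1), −e_1,…,−e_n} ⊂ ℝ^{n+1}, ℝ₊B denotes the set of non-negative real linear combinations of B, and ℕB the set of non-negative integer linear combinations of B. -/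
open Finset

/-- The system `x ≥ 0, xA ≤ 𝟙` is totally dual integral: for every integral
`α` for which the minimum in the LP-duality equation
`max{⟨α,x⟩ : x ≥ 0, xA ≤ 𝟙} = min{⟨y,𝟙⟩ : y ≥ 0, Ay ≥ α}` is finite
(equivalently, the dual program is feasible; the minimum is then automatically
bounded below by `0`), the minimum is attained at an integral vector `y ≥ 0`. -/
def IsTDI {n q : ℕ} (A : Matrix (Fin n) (Fin q) ℝ) : Prop :=
  ∀ α : Fin n → ℤ,
    (∃ y : Fin q → ℝ, (∀ j, 0 ≤ y j) ∧ ∀ i, (α i : ℝ) ≤ ∑ j, A i j * y j) →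
    ∃ y : Fin q → ℕ,
      (∀ i, (α i : ℝ) ≤ ∑ j, A i j * (y j : ℝ)) ∧
      ∀ y' : Fin q → ℝ, (∀ j, 0 ≤ y' j) → (∀ i, (α i : ℝ) ≤ ∑ j, A i j * y' j) →
        (∑ j, (y j : ℝ)) ≤ ∑ j, y' j

/-- The polyhedron `{x ∈ ℝ^n : x ≥ 0, xA ≤ 𝟙}`. -/
def polyQ {n q : ℕ} (A : Matrix (Fin n) (Fin q) ℝ) : Set (Fin n → ℝ) :=
  { x | (∀ i, 0 ≤ x i) ∧ ∀ j, ∑ i, x i * A i j ≤ 1 }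

/-- A polyhedron is integral if all of its vertices (extreme points) have
integer coordinates. -/
def IsIntegralPoly {n : ℕ} (P : Set (Fin n → ℝ)) : Prop :=
  ∀ x ∈ Set.extremePoints ℝ P, ∀ i, ∃ m : ℤ, x i = (m : ℝ)

/-- The cone `ℝ₊B` of non-negative real combinations of
`B = {(v_1,1),…,(v_q,1),−e_1,…,−e_n} ⊂ ℝ^{n+1}`, where `v_1,…,v_q` are the
columns of `A`; vectors of `ℝ^{n+1}` are pairs `(z, z_{n+1}) : (Fin n → ℝ) × ℝ`. -/
def coneB {n q : ℕ} (A : Matrix (Fin n) (Fin q) ℝ) : Set ((Fin n → ℝ) × ℝ) :=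
  { z | ∃ (η : Fin q → ℝ) (δ : Fin n → ℝ), (∀ j, 0 ≤ η j) ∧ (∀ i, 0 ≤ δ i) ∧
      (∀ i, z.1 i = (∑ j, η j * A i j) - δ i) ∧ z.2 = ∑ j, η j }

/-- The condition `ℝ₊B ∩ ℤ^{n+1} = ℕB`: an integral vector lies in the cone
generated by `B` if and only if it is a non-negative *integer* combination of
the elements of `B`. -/
def HilbertBasisB {n q : ℕ} (A : Matrix (Fin n) (Fin q) ℝ) : Prop :=
  ∀ z : (Fin n → ℤ) × ℤ,
    ((fun i => (z.1 i : ℝ)), (z.2 : ℝ)) ∈ coneB A ↔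
    ∃ (η : Fin q → ℕ) (δ : Fin n → ℕ),
      (∀ i, (z.1 i : ℝ) = (∑ j, (η j : ℝ) * A i j) - (δ i : ℝ)) ∧
      (z.2 : ℝ) = ∑ j, (η j : ℝ)

/-- A linear functional on `ℝ^n` is determined by its values on the unit vectors. -/
theorem LinearMap.apply_eq_sum_mul_single {n : ℕ} (f : (Fin n → ℝ) →ₗ[ℝ] ℝ) (z : Fin n → ℝ) :
    f z = ∑ i, z i * f (Pi.single i 1) := by
  conv_lhs => rw [← Finset.univ_sum_single z, map_sum]
  refine Finset.sum_congr rfl fun i _ => ?_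
  rw [← smul_eq_mul, ← map_smul, ← Pi.single_smul', smul_eq_mul, mul_one]

/-- At a vertex of `polyQ A`, the columns of the tight constraints span the coordinates on which
the vertex does not vanish. -/
theorem exists_tight_combination_of_mem_extremePoints {n q : ℕ} {A : Matrix (Fin n) (Fin q) ℝ}
    {x : Fin n → ℝ} (hx : x ∈ Set.extremePoints ℝ (polyQ A)) (u : Fin n → ℝ) :
    ∃ c : Fin q → ℝ, (∀ j, ∑ i, x i * A i j ≠ 1 → c j = 0) ∧
      ∀ i, x i ≠ 0 → ∑ j, A i j * c j = u i := by
  classical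
  obtain ⟨⟨hx0, hx1⟩, hext⟩ := mem_extremePoints.1 hx
  let v : Fin q ⊕ Fin n → (Fin n → ℝ) := Sum.elim
    (fun j => if ∑ i, x i * A i j = 1 then fun i => A i j else 0)
    (fun i => if x i = 0 then Pi.single i 1 else 0)
  have hspan : Submodule.span ℝ (Set.range v) = ⊤ := by
    by_contra hne
    obtain ⟨f, hf, hker⟩ := Submodule.exists_le_ker_of_lt_top _ (lt_top_iff_ne_top.2 hne)
    have hfv : ∀ k, f (v k) = 0 := fun k => hker (Submodule.subset_span ⟨k, rfl⟩)
    let w : Fin n → ℝ := fun i => f (Pi.single i 1)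
    have hfw : ∀ z, f z = ∑ i, z i * w i := f.apply_eq_sum_mul_single
    have hw0 : ∀ i, x i = 0 → w i = 0 := fun i hi => by
      simpa [v, hi] using hfv (Sum.inr i)
    have hw1 : ∀ j, ∑ i, x i * A i j = 1 → ∑ i, w i * A i j = 0 := fun j hj => by
      have := hfv (Sum.inl j)
      simp only [v, Sum.elim_inl, hj, if_true, hfw] at this
      simpa [mul_comm] using this
    have hmem : ∀ᶠ ε in nhds (0 : ℝ), x + ε • w ∈ polyQ A := by
      refine Filter.Eventually.and (Filter.eventually_all.2 fun i => ?_)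
        (Filter.eventually_all.2 fun j => ?_)
      · by_cases hi : x i = 0
        · simp [hi, hw0 i hi]
        · have hpos : 0 < x i := lt_of_le_of_ne (hx0 i) (Ne.symm hi)
          have hc : Continuous fun ε : ℝ => x i + ε * w i := by fun_prop
          have := (hc.tendsto 0).eventually_const_lt (u := 0) (by simpa using hpos)
          exact this.mono fun ε h => h.le
      · have hsum : ∀ ε : ℝ, ∑ i, (x + ε • w) i * A i j =
            ∑ i, x i * A i j + ε * ∑ i, w i * A i j := fun ε => by
          simp [add_mul, Finset.sum_add_distrib, Finset.mul_sum, mul_assoc]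
        simp only [hsum]
        by_cases hj : ∑ i, x i * A i j = 1
        · simp [hj, hw1 j hj]
        · have hlt := lt_of_le_of_ne (hx1 j) hj
          have hc : Continuous fun ε : ℝ => ∑ i, x i * A i j + ε * ∑ i, w i * A i j := by fun_prop
          have := (hc.tendsto 0).eventually_lt_const (u := 1) (by simpa using hlt)
          exact this.mono fun ε h => h.le
    obtain ⟨r, hr, hball⟩ := Metric.eventually_nhds_iff.1 hmem
    have hp := hball (y := r / 2) (by simp [abs_of_pos hr]; linarith)
    have hm := hball (y := -(r / 2)) (by simp [abs_of_pos hr]; linarith)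
    have hseg : x ∈ openSegment ℝ (x + (r / 2) • w) (x + (-(r / 2)) • w) :=
      ⟨1 / 2, 1 / 2, by norm_num, by norm_num, by norm_num, by module⟩
    have heq := (hext _ hp _ hm hseg).1
    have hw : w = 0 := by
      have : (r / 2) • w = 0 := by simpa using heq
      exact (smul_eq_zero.1 this).resolve_left (by positivity)
    exact hf (LinearMap.ext fun z => by simp [hfw, hw])
  obtain ⟨c, hc⟩ := (Submodule.mem_span_range_iff_exists_fun ℝ).1
    (hspan ▸ Submodule.mem_top : u ∈ Submodule.span ℝ (Set.range v))
  refine ⟨fun j => if ∑ i, x i * A i j = 1 then c (Sum.inl j) else 0,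
    fun j hj => by simp [hj], fun i hi => ?_⟩
  have := congrFun hc i
  rw [Fintype.sum_sum_type] at this
  simp only [v, Sum.elim_inl, Sum.elim_inr, Pi.add_apply, Finset.sum_apply, Pi.smul_apply] at this
  rw [Finset.sum_eq_zero (s := Finset.univ) (f := fun k : Fin n => _ • _), add_zero] at this
  · rw [← this]
    refine Finset.sum_congr rfl fun j _ => ?_
    by_cases hj : ∑ i, x i * A i j = 1
    · simp only [if_pos hj, smul_eq_mul, mul_comm (A i j)]
    · simp [hj]
  · intro k _
    by_cases hk : x k = 0
    · have : i ≠ k := fun h => hi (h ▸ hk)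
      simp [hk, this]
    · simp [hk]

/-- Weak duality for the program `max{⟨α,x⟩ : x ≥ 0, xA ≤ 𝟙}`. -/
theorem sum_mul_le_sum_of_mem_polyQ {n q : ℕ} {A : Matrix (Fin n) (Fin q) ℝ}
    {x α : Fin n → ℝ} {y : Fin q → ℝ} (hx : x ∈ polyQ A) (hy : ∀ j, 0 ≤ y j)
    (hα : ∀ i, α i ≤ ∑ j, A i j * y j) : ∑ i, x i * α i ≤ ∑ j, y j :=
  calc ∑ i, x i * α i ≤ ∑ i, x i * ∑ j, A i j * y j :=
        Finset.sum_le_sum fun i _ => mul_le_mul_of_nonneg_left (hα i) (hx.1 i)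
    _ = ∑ j, (∑ i, x i * A i j) * y j := by
        simp only [Finset.mul_sum, Finset.sum_mul, mul_assoc]
        exact Finset.sum_comm
    _ ≤ ∑ j, y j := Finset.sum_le_sum fun j _ => mul_le_of_le_one_left (hy j) (hx.2 j)

/-- Total dual integrality implies integrality of the polyhedron. -/
theorem IsTDI.isIntegralPoly {n q : ℕ} {A : Matrix (Fin n) (Fin q) ℕ}
    (h : IsTDI (fun i j => (A i j : ℝ))) : IsIntegralPoly (polyQ (fun i j => (A i j : ℝ))) := by
  classical
  intro x hx i₀
  obtain ⟨c, hc0, hc⟩ := exists_tight_combination_of_mem_extremePoints hx (Pi.single i₀ 1)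
  have hxP : x ∈ polyQ (fun i j => (A i j : ℝ)) := hx.1
  by_cases hi₀ : x i₀ = 0
  · exact ⟨0, by simpa using hi₀⟩
  obtain ⟨k, hk⟩ := exists_nat_ge (∑ j, |c j|)
  have hk' : ∀ j, 0 ≤ c j + k := fun j => by
    have := Finset.single_le_sum (f := fun j => |c j|) (fun j _ => abs_nonneg _)
      (Finset.mem_univ j)
    have := neg_abs_le (c j)
    linarith
  let t : Fin q → ℕ := fun j => if ∑ i, x i * (A i j : ℝ) = 1 then k else 0
  let y : Fin q → ℝ := fun j => c j + t j
  have hy : ∀ j, 0 ≤ y j := fun j => by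
    by_cases hj : ∑ i, x i * (A i j : ℝ) = 1
    · simpa [y, t, hj] using hk' j
    · simp [y, t, hj, hc0 j hj]
  let α : Fin n → ℤ := fun i =>
    if x i = 0 then 0 else (∑ j, (A i j : ℤ) * t j) + (Pi.single i₀ 1 : Fin n → ℤ) i
  have hα : ∀ i, x i ≠ 0 → (α i : ℝ) = ∑ j, (A i j : ℝ) * y j := fun i hi => by
    have := hc i hi
    simp only [α, if_neg hi, y, mul_add, Finset.sum_add_distrib, this]
    by_cases h' : i = i₀
    · subst h'; simp [add_comm]
    · simp [h']
  have hα' : ∀ i, (α i : ℝ) ≤ ∑ j, (A i j : ℝ) * y j := fun i => by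
    by_cases hi : x i = 0
    · simp only [α, if_pos hi, Int.cast_zero]
      exact Finset.sum_nonneg fun j _ => mul_nonneg (Nat.cast_nonneg _) (hy j)
    · exact (hα i hi).le
  have hval : ∑ i, x i * (α i : ℝ) = ∑ j, y j := by
    calc ∑ i, x i * (α i : ℝ) = ∑ i, x i * ∑ j, (A i j : ℝ) * y j :=
          Finset.sum_congr rfl fun i _ => by
            by_cases hi : x i = 0
            · simp [hi]
            · rw [hα i hi]
      _ = ∑ j, (∑ i, x i * (A i j : ℝ)) * y j := by
          simp only [Finset.mul_sum, Finset.sum_mul, mul_assoc]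
          exact Finset.sum_comm
      _ = ∑ j, y j := Finset.sum_congr rfl fun j _ => by
          by_cases hj : ∑ i, x i * (A i j : ℝ) = 1
          · rw [hj, one_mul]
          · simp [y, t, hj, hc0 j hj]
  have hval' : ∑ i, x i * (α i : ℝ) = x i₀ + ∑ j, (t j : ℝ) := by
    calc ∑ i, x i * (α i : ℝ)
        = ∑ i, (x i * (Pi.single i₀ 1 : Fin n → ℝ) i + ∑ j, x i * (A i j : ℝ) * t j) :=
          Finset.sum_congr rfl fun i _ => by
            by_cases hi : x i = 0
            · simp [hi]
            · simp only [α, if_neg hi]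
              by_cases h' : i = i₀
              · subst h'; simp [mul_add, Finset.mul_sum, mul_assoc, add_comm]
              · simp [h', Finset.mul_sum, mul_assoc]
      _ = x i₀ + ∑ j, (∑ i, x i * (A i j : ℝ)) * t j := by
          rw [Finset.sum_add_distrib, Finset.sum_comm]
          simp [Finset.sum_mul, Pi.single_apply]
      _ = x i₀ + ∑ j, (t j : ℝ) := by
          congr 1
          refine Finset.sum_congr rfl fun j _ => ?_
          by_cases hj : ∑ i, x i * (A i j : ℝ) = 1
          · rw [hj, one_mul]
          · simp [t, hj]
  obtain ⟨z, hz, hmin⟩ := h α ⟨y, hy, hα'⟩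
  have hle := hmin y hy hα'
  have hge := sum_mul_le_sum_of_mem_polyQ hxP (y := fun j => (z j : ℝ))
    (fun j => Nat.cast_nonneg _) hz
  refine ⟨∑ j, (z j : ℤ) - ∑ j, (t j : ℤ), ?_⟩
  push_cast
  linarith

/-- Total dual integrality implies the Hilbert basis property. -/
theorem IsTDI.hilbertBasisB {n q : ℕ} {A : Matrix (Fin n) (Fin q) ℕ}
    (h : IsTDI (fun i j => (A i j : ℝ))) : HilbertBasisB (fun i j => (A i j : ℝ)) := by
  classical
  rintro ⟨a, b⟩
  constructor
  · rintro ⟨η, δ, hη, hδ, ha, hb⟩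
    simp only at ha hb
    have haη : ∀ i, (a i : ℝ) ≤ ∑ j, (A i j : ℝ) * η j := fun i => by
      simp only [mul_comm _ (η _)]
      linarith [ha i, hδ i]
    obtain ⟨y, hy, hmin⟩ := h a ⟨η, hη, haη⟩
    have hyb : ∑ j, (y j : ℤ) ≤ b := by
      have := hmin η hη haη
      rw [← hb] at this
      exact_mod_cast this
    obtain ⟨y', hyy', hy'⟩ : ∃ y' : Fin q → ℕ, (∀ j, y j ≤ y' j) ∧ ∑ j, (y' j : ℤ) = b := by
      rcases isEmpty_or_nonempty (Fin q) with hq | ⟨⟨j₀⟩⟩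
      · refine ⟨y, fun _ => le_rfl, ?_⟩
        simp only [Finset.univ_eq_empty, Finset.sum_empty] at hb ⊢
        exact_mod_cast hb.symm
      · refine ⟨y + Pi.single j₀ (b - ∑ j, (y j : ℤ)).toNat, fun j => by simp, ?_⟩
        have : ∑ j, ((Pi.single j₀ (b - ∑ j, (y j : ℤ)).toNat : Fin q → ℕ) j : ℤ)
            = b - ∑ j, (y j : ℤ) := by
          rw [← Nat.cast_sum, Finset.sum_pi_single']
          simp [hyb]
        simp only [Pi.add_apply, Nat.cast_add, Finset.sum_add_distrib, this]
        ring
    have hle : ∀ i, a i ≤ ∑ j, (y' j : ℤ) * A i j := fun i => by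
      have h1 : a i ≤ ∑ j, (A i j : ℤ) * y j := by
        have := hy i
        beta_reduce at this
        exact_mod_cast this
      refine h1.trans (Finset.sum_le_sum fun j _ => ?_)
      rw [mul_comm]
      exact mul_le_mul_of_nonneg_right (by exact_mod_cast hyy' j) (Nat.cast_nonneg _)
    refine ⟨y', fun i => (∑ j, (y' j : ℤ) * A i j - a i).toNat, fun i => ?_, ?_⟩
    · have : (((∑ j, (y' j : ℤ) * A i j - a i).toNat : ℤ) : ℝ)
          = ((∑ j, (y' j : ℤ) * A i j - a i : ℤ) : ℝ) := by
        rw [Int.toNat_of_nonneg (sub_nonneg.2 (hle i))]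
      rw [Int.cast_natCast] at this
      rw [this]
      push_cast
      ring
    · simp only [← hy']
      push_cast
      rfl
  · rintro ⟨η, δ, h1, h2⟩
    exact ⟨fun j => η j, fun i => δ i, fun j => Nat.cast_nonneg _, fun i => Nat.cast_nonneg _,
      h1, h2⟩

/-- A linear functional that is nonpositive on the directions of the zero rows of `A` attains its
maximum over `polyQ A` at a vertex. -/
theorem exists_mem_extremePoints_forall_sum_mul_le {n q : ℕ} (A : Matrix (Fin n) (Fin q) ℕ)
    (α : Fin n → ℝ) (hα : ∀ i, (∀ j, A i j = 0) → α i ≤ 0) :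
    ∃ x ∈ Set.extremePoints ℝ (polyQ (fun i j => (A i j : ℝ))),
      ∀ z ∈ polyQ (fun i j => (A i j : ℝ)), ∑ i, z i * α i ≤ ∑ i, x i * α i := by
  classical
  set P := polyQ (fun i j => (A i j : ℝ))
  let Q : Set (Fin n → ℝ) := {x | x ∈ P ∧ ∀ i, (∀ j, A i j = 0) → x i = 0}
  have hPQ : IsExtreme ℝ P Q := by
    refine ⟨fun x hx => hx.1, ?_⟩
    rintro u hu v hv x hx ⟨s, t, hs, ht, -, rfl⟩
    refine ⟨hu, fun i hi => ?_⟩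
    have h0 := hx.2 i hi
    simp only [Pi.add_apply, Pi.smul_apply, smul_eq_mul] at h0
    have h1 := mul_nonneg hs.le (hu.1 i)
    have h2 := mul_nonneg ht.le (hv.1 i)
    exact (mul_eq_zero.1 (by linarith : s * u i = 0)).resolve_left hs.ne'
  have hclosed : IsClosed Q := by
    have : Q = (⋂ i, {x | 0 ≤ x i}) ∩ (⋂ j, {x | ∑ i, x i * (A i j : ℝ) ≤ 1}) ∩
        ⋂ i, ⋂ (_ : ∀ j, A i j = 0), {x | x i = 0} := by
      ext x
      simp [Q, P, polyQ]
    rw [this]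
    refine ((isClosed_iInter fun i => ?_).inter (isClosed_iInter fun j => ?_)).inter
      (isClosed_iInter fun i => isClosed_iInter fun _ => ?_)
    · exact isClosed_le continuous_const (continuous_apply i)
    · exact isClosed_le (by fun_prop) continuous_const
    · exact isClosed_eq (continuous_apply i) continuous_const
  have hcompact : IsCompact Q := by
    refine (isCompact_Icc (a := (0 : Fin n → ℝ)) (b := 1)).of_isClosed_subset hclosed ?_
    refine fun x hx => ⟨hx.1.1, fun i => ?_⟩
    by_cases hi : ∀ j, A i j = 0
    · simp [hx.2 i hi]
    · push Not at hi
      obtain ⟨j, hj⟩ := hi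
      have h1 : (1 : ℝ) ≤ A i j := by exact_mod_cast Nat.one_le_iff_ne_zero.2 hj
      calc x i ≤ x i * A i j := le_mul_of_one_le_right (hx.1.1 i) h1
        _ ≤ ∑ i, x i * (A i j : ℝ) := Finset.single_le_sum
            (f := fun i => x i * (A i j : ℝ))
            (fun i _ => mul_nonneg (hx.1.1 i) (Nat.cast_nonneg _)) (Finset.mem_univ i)
        _ ≤ 1 := hx.1.2 j
  have hne : Q.Nonempty := ⟨0, by simp [P, polyQ, Q]⟩
  let l : StrongDual ℝ (Fin n → ℝ) := ∑ i, α i • ContinuousLinearMap.proj i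
  have hl : ∀ x, l x = ∑ i, x i * α i := fun x => by
    simp [l, mul_comm]
  have hexp : IsExposed ℝ Q (l.toExposed Q) := ContinuousLinearMap.toExposed.isExposed
  obtain ⟨x₀, hx₀, hmax₀⟩ := hcompact.exists_isMaxOn hne l.continuous.continuousOn
  obtain ⟨x, hx⟩ := (hexp.isCompact hcompact).extremePoints_nonempty ⟨x₀, hx₀, hmax₀⟩
  refine ⟨x, (hPQ.trans hexp.isExtreme).extremePoints_subset_extremePoints hx, fun z hz => ?_⟩
  let z' : Fin n → ℝ := fun i => if ∀ j, A i j = 0 then 0 else z i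
  have hz' : z' ∈ Q := by
    refine ⟨⟨fun i => ?_, fun j => ?_⟩, fun i hi => by simp [z', hi]⟩
    · have := hz.1 i
      by_cases hi : ∀ j, A i j = 0 <;> simp [z', hi, this]
    · refine le_trans (Finset.sum_le_sum fun i _ => ?_) (hz.2 j)
      by_cases hi : ∀ j, A i j = 0 <;> simp [z', hi]
  have hle : l z' ≤ l x := hx.1.2 z' hz'
  rw [hl, hl] at hle
  refine le_trans (Finset.sum_le_sum fun i _ => ?_) hle
  by_cases hi : ∀ j, A i j = 0
  · simpa [z', hi] using mul_nonpos_of_nonneg_of_nonpos (hz.1 i) (hα i hi)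
  · simp [z', hi]

/-- Strong duality: an upper bound `b` for a functional on `polyQ A` is the value of
a feasible dual solution. -/
theorem exists_dual_of_forall_sum_mul_le {n q : ℕ} [Nonempty (Fin q)]
    {A : Matrix (Fin n) (Fin q) ℝ} (hA : ∀ i j, 0 ≤ A i j) {α : Fin n → ℝ} {b : ℝ}
    (hb : ∀ x ∈ polyQ A, ∑ i, x i * α i ≤ b) :
    ∃ y : Fin q → ℝ, (∀ j, 0 ≤ y j) ∧ (∀ i, α i ≤ ∑ j, A i j * y j) ∧ ∑ j, y j = b := by
  classical
  have hb0 : 0 ≤ b := by simpa using hb 0 (by simp [polyQ])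
  let S : Set (Fin q → ℝ) := (fun y => b • y) '' stdSimplex ℝ (Fin q)
  have hS : ∀ y ∈ S, (∀ j, 0 ≤ y j) ∧ ∑ j, y j = b := by
    rintro _ ⟨y, hy, rfl⟩
    exact ⟨fun j => mul_nonneg hb0 (hy.1 j), by simp [← Finset.mul_sum, hy.2]⟩
  by_contra! hcon
  let L := A.mulVecLin
  have hdisj : Disjoint (L '' S) (Set.Ici α) := by
    rw [Set.disjoint_left]
    rintro _ ⟨y, hy, rfl⟩ hα
    exact hcon y (hS y hy).1 (fun i => hα i) (hS y hy).2
  obtain ⟨f, u, v, hfu, huv, hfv⟩ := geometric_hahn_banach_compact_closed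
    (((convex_stdSimplex ℝ (Fin q)).smul b).linear_image L)
    (((isCompact_stdSimplex ℝ (Fin q)).smul b).image L.continuous_of_finiteDimensional)
    (convex_Ici α) isClosed_Ici hdisj
  let w : Fin n → ℝ := fun i => f (Pi.single i 1)
  have hfw : ∀ z, f z = ∑ i, w i * z i := fun z => by
    simp only [mul_comm (w _)]
    exact f.toLinearMap.apply_eq_sum_mul_single z
  have hfα : v < f α := hfv α Set.self_mem_Ici
  have hw : ∀ i, 0 ≤ w i := fun i => by
    by_contra! hi
    have hpos : 0 ≤ (f α - v) / (-w i) := div_nonneg (by linarith) (by linarith)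
    have := hfv (α + ((f α - v) / (-w i)) • Pi.single i 1) (by
      simp only [Set.mem_Ici, le_add_iff_nonneg_right]
      exact smul_nonneg hpos (by simp))
    rw [map_add, map_smul, smul_eq_mul] at this
    change v < f α + (f α - v) / (-w i) * w i at this
    have h2 : (f α - v) / (-w i) * w i = -(f α - v) := by
      field_simp [hi.ne]
    linarith
  have hcol : ∀ j, b * ∑ i, w i * A i j < u := fun j => by
    have := hfu (L (b • Pi.single j 1))
      ⟨_, ⟨_, single_mem_stdSimplex ℝ j, rfl⟩, rfl⟩
    rw [map_smul, map_smul, smul_eq_mul, hfw] at this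
    simpa [L] using this
  have hcol0 : ∀ j, 0 ≤ ∑ i, w i * A i j := fun j =>
    Finset.sum_nonneg fun i _ => mul_nonneg (hw i) (hA i j)
  obtain ⟨j₀⟩ := ‹Nonempty (Fin q)›
  have hu : 0 < u := (mul_nonneg hb0 (hcol0 j₀)).trans_lt (hcol j₀)
  have key : ∀ c : ℝ, 0 ≤ c → (∀ j, c * ∑ i, w i * A i j ≤ 1) → c * f α ≤ b := fun c hc h1 => by
    have := hb (c • w) ⟨fun i => mul_nonneg hc (hw i), fun j => by
      simpa [Finset.mul_sum, mul_assoc] using h1 j⟩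
    simpa [hfw, Finset.mul_sum, mul_assoc] using this
  rcases hb0.eq_or_lt with h0 | hbpos
  · have hs : 0 ≤ ∑ j, ∑ i, w i * A i j := Finset.sum_nonneg fun j _ => hcol0 j
    have := key (1 / (1 + ∑ j, ∑ i, w i * A i j)) (by positivity) fun j => by
      have := Finset.single_le_sum (f := fun j => ∑ i, w i * A i j) (fun j _ => hcol0 j)
        (Finset.mem_univ j)
      rw [one_div, inv_mul_le_iff₀ (by positivity)]
      linarith
    have hpos : 0 < 1 / (1 + ∑ j, ∑ i, w i * A i j) * f α :=
      mul_pos (by positivity) (by linarith)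
    linarith
  · have := key (b / u) (by positivity) fun j => by
      rw [div_mul_eq_mul_div, div_le_one hu]
      exact (hcol j).le
    rw [div_mul_eq_mul_div, div_le_iff₀ hu] at this
    have := le_of_mul_le_mul_left this hbpos
    linarith

/-- Let `A` be an `n × q` matrix with entries in `ℕ` and
columns `v_1,…,v_q`. The system `x ≥ 0, xA ≤ 𝟙` is TDI if and only if
(i) the polyhedron `{x : x ≥ 0, xA ≤ 𝟙}` is integral, and
(ii) `ℝ₊B ∩ ℤ^{n+1} = ℕB` for `B = {(v_1,1),…,(v_q,1),−e_1,…,−e_n}`. -/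
theorem tdi_iff_integral_and_hilbert {n q : ℕ} (A : Matrix (Fin n) (Fin q) ℕ) :
    IsTDI (fun i j => (A i j : ℝ)) ↔
      IsIntegralPoly (polyQ (fun i j => (A i j : ℝ))) ∧
      HilbertBasisB (fun i j => (A i j : ℝ)) := by
  refine ⟨fun h => ⟨h.isIntegralPoly, h.hilbertBasisB⟩, ?_⟩
  rintro ⟨hint, hhil⟩ α ⟨y₀, hy₀, hα₀⟩
  rcases isEmpty_or_nonempty (Fin q) with hq | hq
  · exact ⟨0, fun i => by simpa using hα₀ i, fun y' _ _ => by simp⟩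
  obtain ⟨x, hx, hmax⟩ := exists_mem_extremePoints_forall_sum_mul_le A (fun i => (α i : ℝ))
    fun i hi => by simpa [hi] using hα₀ i
  choose m hm using hint x hx
  obtain ⟨y, hy, hαy, hsum⟩ := exists_dual_of_forall_sum_mul_le
    (fun i j => Nat.cast_nonneg (A i j)) hmax
  obtain ⟨η, δ, h1, h2⟩ := (hhil (α, ∑ i, m i * α i)).1
    ⟨y, fun i => ∑ j, (A i j : ℝ) * y j - α i, hy, fun i => sub_nonneg.2 (hαy i),
      fun i => by simp [mul_comm], by simp [hsum, hm]⟩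
  refine ⟨η, fun i => ?_, fun y' hy' hαy' => ?_⟩
  · have := h1 i
    simp only [mul_comm (η _ : ℝ)] at this
    have hδ : (0 : ℝ) ≤ δ i := Nat.cast_nonneg _
    linarith
  · rw [← h2]
    refine le_trans (le_of_eq ?_) (sum_mul_le_sum_of_mem_polyQ hx.1 hy' hαy')
    simp [hm]
end

section
/- Let A be an n×q matrix with entries in ℤ and column vectors v_1,…,v_q. If (i) the polyhedron { x ∈ ℝ^n : x ≥ 0, xA ≤ 𝟙 } is integral, and (ii) ℝ₊B ∩ ℤ^{n+1} = ℕB for B = {(v_1,1),…,(v_q,1), −e_1,…,−e_n}, then the system x ≥ 0, xA ≤ 𝟙 is totally dual integral. -/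
open Finset

/-- **Farkas' lemma**: a linear functional that is nonpositive wherever finitely many given
functionals are nonpositive is a nonnegative combination of them. -/
lemma exists_nonneg_sum_eq_of_forall_nonpos {ι V : Type*} [AddCommGroup V] [Module ℝ V]
    (s : Finset ι) (a : ι → V →ₗ[ℝ] ℝ) (b : V →ₗ[ℝ] ℝ)
    (h : ∀ x, (∀ i ∈ s, a i x ≤ 0) → b x ≤ 0) :
    ∃ c : ι → ℝ, (∀ i, 0 ≤ c i) ∧ ∀ x, b x = ∑ i ∈ s, c i * a i x := by
  classical
  induction s using Finset.induction_on generalizing a b with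
  | empty =>
    refine ⟨0, fun _ => le_rfl, fun x => ?_⟩
    have hpos := h x (by simp)
    have hneg := h (-x) (by simp)
    simp only [map_neg] at hneg
    simp only [Finset.sum_empty]
    linarith
  | insert k s hk ih =>
    by_cases hs : ∀ x, (∀ i ∈ s, a i x ≤ 0) → b x ≤ 0
    · obtain ⟨c, hc, hb⟩ := ih a b hs
      refine ⟨Function.update c k 0, fun i => ?_, fun x => ?_⟩
      · by_cases hik : i = k
        · simp [hik]
        · simpa [hik] using hc i
      · rw [Finset.sum_insert hk, hb x]
        simp only [Function.update_self, zero_mul, zero_add]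
        refine Finset.sum_congr rfl fun i hi => ?_
        rw [Function.update_of_ne (ne_of_mem_of_not_mem hi hk)]
    · push Not at hs
      obtain ⟨u, hu, hbu⟩ := hs
      have hku : 0 < a k u := by
        by_contra hcon
        refine absurd (h u fun i hi => ?_) (not_le.2 hbu)
        rcases Finset.mem_insert.1 hi with rfl | hi
        · exact not_lt.1 hcon
        · exact hu i hi
      obtain ⟨c, hc, hb⟩ := ih (fun i => a i - (a i u / a k u) • a k)
        (b - (b u / a k u) • a k) (fun x hx => by
          have hz := h (x - (a k x / a k u) • u) (fun i hi => by
            rcases Finset.mem_insert.1 hi with rfl | hi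
            · simp only [map_sub, map_smul, smul_eq_mul]
              rw [div_mul_cancel₀ _ hku.ne', sub_self]
            · have := hx i hi
              simp only [LinearMap.sub_apply, LinearMap.smul_apply, smul_eq_mul] at this
              simp only [map_sub, map_smul, smul_eq_mul]
              calc _ = _ := by ring
                _ ≤ 0 := this)
          simp only [map_sub, map_smul, smul_eq_mul] at hz
          simp only [LinearMap.sub_apply, LinearMap.smul_apply, smul_eq_mul]
          calc _ = _ := by ring
            _ ≤ 0 := hz)
      refine ⟨Function.update c k ((b u - ∑ i ∈ s, c i * a i u) / a k u),
        fun i => ?_, fun x => ?_⟩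
      · by_cases hik : i = k
        · subst hik
          rw [Function.update_self]
          refine div_nonneg ?_ hku.le
          have : ∑ i ∈ s, c i * a i u ≤ 0 :=
            Finset.sum_nonpos fun i hi => mul_nonpos_of_nonneg_of_nonpos (hc i) (hu i hi)
          linarith
        · simpa [hik] using hc i
      · have hbx := hb x
        simp only [LinearMap.sub_apply, LinearMap.smul_apply, smul_eq_mul, mul_sub,
          Finset.sum_sub_distrib] at hbx
        have hsum : ∑ i ∈ s, c i * (a i u / a k u * a k x)
            = (∑ i ∈ s, c i * a i u) / a k u * a k x := by
          rw [Finset.sum_div, Finset.sum_mul]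
          exact Finset.sum_congr rfl fun i _ => by ring
        rw [Finset.sum_insert hk, Function.update_self]
        have hupd : ∑ i ∈ s, Function.update c k ((b u - ∑ i ∈ s, c i * a i u) / a k u) i * a i x
            = ∑ i ∈ s, c i * a i x :=
          Finset.sum_congr rfl fun i hi => by
            rw [Function.update_of_ne (ne_of_mem_of_not_mem hi hk)]
        rw [hupd, sub_div, sub_mul]
        linarith

section Polyhedron

variable {κ V : Type*} [AddCommGroup V] [Module ℝ V]

/-- At a point of a pointed polyhedron that is not extreme, if `f` is bounded above on the
polyhedron, there is a direction along which `f` does not decrease, the tight constraints stay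
tight, and some constraint increases. -/
lemma exists_direction_of_not_mem_extremePoints (a : κ → V →ₗ[ℝ] ℝ) (c : κ → ℝ)
    (hpt : ∀ d, (∀ k, a k d = 0) → d = 0) (f : V →ₗ[ℝ] ℝ) {M : ℝ}
    (hM : ∀ x, (∀ k, a k x ≤ c k) → f x ≤ M) {x : V} (hx : ∀ k, a k x ≤ c k)
    (hxe : x ∉ Set.extremePoints ℝ {x | ∀ k, a k x ≤ c k}) :
    ∃ d, 0 ≤ f d ∧ (∀ k, a k x = c k → a k d = 0) ∧ ∃ k, 0 < a k d := by
  obtain ⟨d, hd0, hd⟩ : ∃ d, d ≠ 0 ∧ ∀ k, a k x = c k → a k d = 0 := by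
    rw [mem_extremePoints_iff_left] at hxe
    push Not at hxe
    obtain ⟨u, hu, v, hv, ⟨r, s, hr, hs, hrs, hx'⟩, hne⟩ := hxe hx
    refine ⟨u - x, sub_ne_zero.2 hne, fun k hk => ?_⟩
    have huk := hu k
    have hvk := hv k
    have hsum : r * a k u + s * a k v = a k x := by rw [← hx']; simp
    rw [map_sub]
    have hs' : s = 1 - r := by linarith
    subst hs'
    have : r * (a k u - c k) = (1 - r) * (c k - a k v) := by linarith
    have h1 : 0 ≤ (1 - r) * (c k - a k v) := mul_nonneg hs.le (by linarith)
    have h2 : 0 ≤ a k u - c k := nonneg_of_mul_nonneg_right (this ▸ h1) hr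
    linarith
  have hdk : ∃ k, a k d ≠ 0 := by
    by_contra hcon
    push Not at hcon
    exact hd0 (hpt d hcon)
  have key : ∀ d, 0 < f d → ∃ k, 0 < a k d := by
    intro d hfd
    by_contra hcon
    push Not at hcon
    have hfx := hM x hx
    have := hM (x + ((M - f x + 1) / f d) • d) (fun k => by
      rw [map_add, map_smul, smul_eq_mul]
      have : (M - f x + 1) / f d * a k d ≤ 0 :=
        mul_nonpos_of_nonneg_of_nonpos (div_nonneg (by linarith) hfd.le) (hcon k)
      linarith [hx k])
    rw [map_add, map_smul, smul_eq_mul, div_mul_cancel₀ _ hfd.ne'] at this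
    linarith
  have hdneg : ∀ k, a k x = c k → a k (-d) = 0 := fun k hk => by rw [map_neg, hd k hk, neg_zero]
  rcases lt_trichotomy (f d) 0 with hf | hf | hf
  · have hf' : 0 < f (-d) := by rw [map_neg]; linarith
    exact ⟨-d, hf'.le, hdneg, key _ hf'⟩
  · obtain ⟨k, hk⟩ := hdk
    rcases lt_or_gt_of_ne hk with hk | hk
    · exact ⟨-d, by rw [map_neg, hf, neg_zero], hdneg, k, by rw [map_neg]; linarith⟩
    · exact ⟨d, hf.ge, hd, k, hk⟩
  · exact ⟨d, hf.le, hd, key d hf⟩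

/-- A linear functional bounded above on a pointed polyhedron is dominated, at each point of the
polyhedron, by its value at some extreme point. -/
lemma exists_mem_extremePoints_le [Fintype κ] (a : κ → V →ₗ[ℝ] ℝ) (c : κ → ℝ)
    (hpt : ∀ d, (∀ k, a k d = 0) → d = 0) (f : V →ₗ[ℝ] ℝ) {M : ℝ}
    (hM : ∀ x, (∀ k, a k x ≤ c k) → f x ≤ M) (x : V) (hx : ∀ k, a k x ≤ c k) :
    ∃ z ∈ Set.extremePoints ℝ {x | ∀ k, a k x ≤ c k}, f x ≤ f z := by
  classical
  induction hN : #{k | a k x ≠ c k} using Nat.strong_induction_on generalizing x with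
  | _ N ih =>
  by_cases hxe : x ∈ Set.extremePoints ℝ {x | ∀ k, a k x ≤ c k}
  · exact ⟨x, hxe, le_rfl⟩
  obtain ⟨d, hfd, htight, k₀, hk₀⟩ :=
    exists_direction_of_not_mem_extremePoints a c hpt f hM hx hxe
  obtain ⟨k, hk, hmin⟩ := Finset.exists_min_image ({k | 0 < a k d} : Finset κ)
    (fun k => (c k - a k x) / a k d) ⟨k₀, by simpa using hk₀⟩
  have hkd : 0 < a k d := by simpa using hk
  set t := (c k - a k x) / a k d with ht
  have ht0 : 0 ≤ t := div_nonneg (by linarith [hx k]) hkd.le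
  have hfeas : ∀ l, a l (x + t • d) ≤ c l := by
    intro l
    rw [map_add, map_smul, smul_eq_mul]
    rcases le_or_gt (a l d) 0 with hl | hl
    · linarith [hx l, mul_nonpos_of_nonneg_of_nonpos ht0 hl]
    · have := (le_div_iff₀ hl).1 (hmin l (by simpa using hl))
      linarith
  have hcard : #{l | a l (x + t • d) ≠ c l} < N := by
    rw [← hN]
    refine Finset.card_lt_card (Finset.ssubset_iff_of_subset (fun l => ?_) |>.2 ⟨k, ?_, ?_⟩)
    · simp only [Finset.mem_filter, Finset.mem_univ, true_and, map_add, map_smul, smul_eq_mul]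
      exact mt fun hl => by rw [htight l hl, hl, mul_zero, add_zero]
    · simpa using fun h => hkd.ne' (htight k h)
    · simp only [Finset.mem_filter, Finset.mem_univ, true_and, map_add, map_smul, smul_eq_mul,
        not_not]
      rw [ht, div_mul_cancel₀ _ hkd.ne']
      ring
  obtain ⟨z, hz, hle⟩ := ih _ hcard (x + t • d) hfeas rfl
  refine ⟨z, hz, le_trans ?_ hle⟩
  rw [map_add, map_smul, smul_eq_mul]
  linarith [mul_nonneg ht0 hfd]

end Polyhedron

section LinearProgram

variable {n q : ℕ} {A : Matrix (Fin n) (Fin q) ℝ}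

/-- Weak duality, in homogeneous form: if `w ≥ 0`, `wA ≤ t𝟙`, `y ≥ 0` and `Ay ≥ α`, then
`⟨w, α⟩ ≤ t⟨y, 𝟙⟩`. -/
lemma sum_mul_le_mul_sum {α w : Fin n → ℝ} {y : Fin q → ℝ} {t : ℝ}
    (hy : ∀ j, 0 ≤ y j) (hAy : ∀ i, α i ≤ ∑ j, A i j * y j)
    (hw : ∀ i, 0 ≤ w i) (hwA : ∀ j, ∑ i, w i * A i j ≤ t) :
    ∑ i, w i * α i ≤ t * ∑ j, y j :=
  calc ∑ i, w i * α i ≤ ∑ i, w i * ∑ j, A i j * y j :=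
        Finset.sum_le_sum fun i _ => mul_le_mul_of_nonneg_left (hAy i) (hw i)
    _ = ∑ j, (∑ i, w i * A i j) * y j := by
        simp only [Finset.mul_sum, Finset.sum_mul]
        rw [Finset.sum_comm]
        simp only [mul_assoc]
    _ ≤ ∑ j, t * y j :=
        Finset.sum_le_sum fun j _ => mul_le_mul_of_nonneg_right (hwA j) (hy j)
    _ = t * ∑ j, y j := (Finset.mul_sum _ _ _).symm

/-- Every point of `polyQ A` is dominated by an extreme point with respect to a linear functional
that is bounded above on `polyQ A`. -/
lemma exists_extremePoints_polyQ_le (α : Fin n → ℝ) {M : ℝ}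
    (hM : ∀ x ∈ polyQ A, ∑ i, x i * α i ≤ M) {x : Fin n → ℝ} (hx : x ∈ polyQ A) :
    ∃ z ∈ Set.extremePoints ℝ (polyQ A), ∑ i, x i * α i ≤ ∑ i, z i * α i := by
  let a : Fin n ⊕ Fin q → (Fin n → ℝ) →ₗ[ℝ] ℝ :=
    Sum.elim (fun i => -LinearMap.proj i) (fun j => Fintype.linearCombination ℝ fun i => A i j)
  let c : Fin n ⊕ Fin q → ℝ := Sum.elim 0 1
  have hP : polyQ A = {x | ∀ k, a k x ≤ c k} := by
    ext x
    simp [polyQ, a, c, Fintype.linearCombination_apply]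
  have hmem : ∀ x, x ∈ polyQ A ↔ ∀ k, a k x ≤ c k := fun x => by rw [hP]; rfl
  obtain ⟨z, hz, hle⟩ := exists_mem_extremePoints_le a c
    (fun d hd => funext fun i => by simpa [a] using hd (Sum.inl i))
    (Fintype.linearCombination ℝ α) (M := M)
    (fun x hx => by simpa [Fintype.linearCombination_apply] using hM x ((hmem x).2 hx))
    x ((hmem x).1 hx)
  exact ⟨z, hP ▸ hz, by simpa [Fintype.linearCombination_apply] using hle⟩

/-- Strong duality: if the dual program is feasible and `m` is the maximum of `⟨α, x⟩` over
`polyQ A`, then `(α, m)` lies in the cone `ℝ₊B`. -/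
lemma mem_coneB_of_isGreatest {α : Fin n → ℝ} {m : ℝ}
    (hfeas : ∃ y : Fin q → ℝ, (∀ j, 0 ≤ y j) ∧ ∀ i, α i ≤ ∑ j, A i j * y j)
    (hm : IsGreatest ((fun x => ∑ i, x i * α i) '' polyQ A) m) :
    (α, m) ∈ coneB A := by
  classical
  obtain ⟨y, hy, hAy⟩ := hfeas
  obtain ⟨⟨x₀, hx₀, hx₀m⟩, hub⟩ := hm
  have hmy : m ≤ ∑ j, y j := by
    rw [← hx₀m, ← one_mul (∑ j, y j)]
    exact sum_mul_le_mul_sum hy hAy hx₀.1 hx₀.2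
  let fst := LinearMap.fst ℝ (Fin n → ℝ) ℝ
  let snd := LinearMap.snd ℝ (Fin n → ℝ) ℝ
  let a : Fin q ⊕ Fin n → ((Fin n → ℝ) × ℝ) →ₗ[ℝ] ℝ :=
    Sum.elim (fun j => Fintype.linearCombination ℝ (fun i => A i j) ∘ₗ fst + snd)
      (fun i => -(LinearMap.proj i ∘ₗ fst))
  let b : ((Fin n → ℝ) × ℝ) →ₗ[ℝ] ℝ := Fintype.linearCombination ℝ α ∘ₗ fst + m • snd
  obtain ⟨l, hl, hb⟩ := exists_nonneg_sum_eq_of_forall_nonpos Finset.univ a b (by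
    rintro ⟨w, s⟩ h
    have hwA : ∀ j, ∑ i, w i * A i j ≤ -s := fun j => by
      have := h (Sum.inl j) (Finset.mem_univ _)
      simp only [a, fst, snd, Sum.elim_inl, LinearMap.add_apply, LinearMap.comp_apply,
        LinearMap.fst_apply, LinearMap.snd_apply, Fintype.linearCombination_apply,
        smul_eq_mul] at this
      linarith
    have hw : ∀ i, 0 ≤ w i := fun i => by
      simpa [a, fst] using h (Sum.inr i) (Finset.mem_univ _)
    have hweak := sum_mul_le_mul_sum hy hAy hw hwA
    simp only [b, fst, snd, LinearMap.add_apply, LinearMap.comp_apply, LinearMap.smul_apply,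
      LinearMap.fst_apply, LinearMap.snd_apply, Fintype.linearCombination_apply, smul_eq_mul]
    rcases le_or_gt 0 s with hs | hs
    · nlinarith [mul_le_mul_of_nonneg_left hmy hs]
    · have hs' : 0 < (-s)⁻¹ := inv_pos.2 (by linarith)
      have hmem : (-s)⁻¹ • w ∈ polyQ A := by
        refine ⟨fun i => mul_nonneg hs'.le (hw i), fun j => ?_⟩
        simp only [Pi.smul_apply, smul_eq_mul, mul_assoc, ← Finset.mul_sum]
        rw [inv_mul_le_iff₀ (by linarith), mul_one]
        exact hwA j
      have := hub ⟨_, hmem, rfl⟩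
      simp only [Pi.smul_apply, smul_eq_mul, mul_assoc, ← Finset.mul_sum] at this
      rw [inv_mul_le_iff₀ (by linarith)] at this
      linarith)
  refine ⟨fun j => l (Sum.inl j), fun i => l (Sum.inr i), fun _ => hl _, fun _ => hl _,
    fun i => ?_, ?_⟩
  · have := hb (Pi.single i 1, 0)
    simpa [a, b, fst, snd, Fintype.linearCombination_apply, Pi.single_apply, sub_eq_add_neg]
      using this
  · have := hb (0, 1)
    simpa [a, b, fst, snd, Fintype.linearCombination_apply] using this

/-- If `polyQ A` is integral, `α` is integral and the dual program is feasible, then the maximum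
of `⟨α, x⟩` over `polyQ A` exists and is an integer. -/
lemma exists_int_isGreatest (hA : IsIntegralPoly (polyQ A)) (α : Fin n → ℤ)
    (hfeas : ∃ y : Fin q → ℝ, (∀ j, 0 ≤ y j) ∧ ∀ i, (α i : ℝ) ≤ ∑ j, A i j * y j) :
    ∃ m : ℤ, IsGreatest ((fun x => ∑ i, x i * (α i : ℝ)) '' polyQ A) m := by
  obtain ⟨y, hy, hAy⟩ := hfeas
  have hbound : ∀ x ∈ polyQ A, ∑ i, x i * (α i : ℝ) ≤ ∑ j, y j := fun x hx => by
    simpa using sum_mul_le_mul_sum hy hAy hx.1 hx.2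
  let S : Set ℤ := {k | ∃ z ∈ Set.extremePoints ℝ (polyQ A), ∑ i, z i * (α i : ℝ) = k}
  have hint : ∀ z ∈ Set.extremePoints ℝ (polyQ A), ∃ k : ℤ, ∑ i, z i * (α i : ℝ) = k := by
    intro z hz
    choose p hp using hA z hz
    exact ⟨∑ i, p i * α i, by push_cast; simp only [hp]⟩
  have h0 : (0 : Fin n → ℝ) ∈ polyQ A := by simp [polyQ]
  obtain ⟨z₀, hz₀, -⟩ := exists_extremePoints_polyQ_le (fun i => (α i : ℝ)) hbound h0
  obtain ⟨k₀, hk₀⟩ := hint z₀ hz₀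
  obtain ⟨m, ⟨z, hz, hzm⟩, hmax⟩ := Int.exists_greatest_of_bdd (P := (· ∈ S))
    ⟨⌊∑ j, y j⌋, by
      rintro k ⟨z, hz, hzk⟩
      exact Int.le_floor.2 (hzk ▸ hbound z hz.1)⟩ ⟨k₀, z₀, hz₀, hk₀⟩
  refine ⟨m, ⟨z, hz.1, hzm⟩, ?_⟩
  rintro _ ⟨x, hx, rfl⟩
  obtain ⟨u, hu, hxu⟩ := exists_extremePoints_polyQ_le (fun i => (α i : ℝ)) hbound hx
  obtain ⟨k, hk⟩ := hint u hu
  exact hxu.trans (hk ▸ by exact_mod_cast hmax k ⟨u, hu, hk⟩)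

end LinearProgram

/-- Let `A` be an `n × q` matrix with entries in `ℤ` and
columns `v_1,…,v_q`. If (i) the polyhedron `{x : x ≥ 0, xA ≤ 𝟙}` is integral
and (ii) `ℝ₊B ∩ ℤ^{n+1} = ℕB` for `B = {(v_1,1),…,(v_q,1),−e_1,…,−e_n}`, then
the system `x ≥ 0, xA ≤ 𝟙` is TDI. -/
theorem tdi_of_integral_and_hilbert {n q : ℕ} (A : Matrix (Fin n) (Fin q) ℤ)
    (h1 : IsIntegralPoly (polyQ (fun i j => (A i j : ℝ))))
    (h2 : HilbertBasisB (fun i j => (A i j : ℝ))) :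
    IsTDI (fun i j => (A i j : ℝ)) := by
  intro α hfeas
  obtain ⟨m, hm⟩ := exists_int_isGreatest h1 α hfeas
  obtain ⟨η, δ, hη, hηm⟩ := (h2 (α, m)).1 (mem_coneB_of_isGreatest hfeas hm)
  refine ⟨η, fun i => ?_, fun y hy hAy => ?_⟩
  · rw [show (α i : ℝ) = _ from hη i]
    simp only [mul_comm]
    linarith [(δ i).cast_nonneg (α := ℝ)]
  · obtain ⟨⟨x, hx, hxm⟩, -⟩ := hm
    rw [← hηm]
    refine hxm.symm.trans_le ?_
    simpa using sum_mul_le_mul_sum hy hAy hx.1 hx.2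
end

section
/- Let A be a perfect {0,1}-matrix of size n×q with column vectors v_1,…,v_q, and suppose there exists x_0 ∈ ℝ^n with all entries positive such that ⟨v_i, x_0⟩ = 1 for all i. Then the Ehrhart ring of P = conv(v_1,…,v_q) equals the monomial subring K[x^{v_1}t,…,x^{v_q}t]; equivalently, for every b ∈ ℕ and every lattice point a ∈ bP ∩ ℤ^n there exist η_1,…,η_q ∈ ℕ with Σ_i η_i = b and a = Σ_i η_i v_i. -/
open Finset

/-- The face of `polyQ A` on which the coordinates indexed by zero rows of `A` vanish. -/
def polyQFace {n q : ℕ} (A : Matrix (Fin n) (Fin q) ℝ) : Set (Fin n → ℝ) :=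
  { x | x ∈ polyQ A ∧ ∀ i, (∀ j, A i j = 0) → x i = 0 }

theorem mul_le_one_of_mem_polyQ {n q : ℕ} {A : Matrix (Fin n) (Fin q) ℝ}
    (hA : ∀ i j, 0 ≤ A i j) {x : Fin n → ℝ} (hx : x ∈ polyQ A) (i : Fin n) (j : Fin q) :
    x i * A i j ≤ 1 :=
  (single_le_sum (f := fun i => x i * A i j)
    (fun k _ => mul_nonneg (hx.1 k) (hA k j)) (mem_univ i)).trans (hx.2 j)

theorem isClosed_polyQ {n q : ℕ} (A : Matrix (Fin n) (Fin q) ℝ) : IsClosed (polyQ A) := by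
  have h : polyQ A = (⋂ i, {x | 0 ≤ x i}) ∩ ⋂ j, {x | ∑ i, x i * A i j ≤ 1} := by
    ext x
    simp [polyQ]
  rw [h]
  exact (isClosed_iInter fun i => isClosed_le continuous_const (by fun_prop)).inter
    (isClosed_iInter fun j => isClosed_le (by fun_prop) continuous_const)

theorem isCompact_polyQFace {n q : ℕ} {A : Matrix (Fin n) (Fin q) ℝ}
    (hA : ∀ i j, 0 ≤ A i j) : IsCompact (polyQFace A) := by
  have hclosed : IsClosed (polyQFace A) := by
    have h : polyQFace A = polyQ A ∩ ⋂ i, ⋂ (_ : ∀ j, A i j = 0), {x | x i = 0} := by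
      ext x
      simp [polyQFace]
    rw [h]
    exact (isClosed_polyQ A).inter (isClosed_iInter fun i => isClosed_iInter fun _ =>
      isClosed_eq (by fun_prop) continuous_const)
  refine (isCompact_Icc (a := (0 : Fin n → ℝ)) (b := fun i => ∑ j, (A i j)⁻¹)).of_isClosed_subset
    hclosed fun x hx => ⟨hx.1.1, fun i => ?_⟩
  have hnonneg : ∀ j ∈ univ, 0 ≤ (A i j)⁻¹ := fun j _ => inv_nonneg.2 (hA i j)
  by_cases hi : ∀ j, A i j = 0
  · rw [hx.2 i hi]
    exact sum_nonneg hnonneg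
  · push Not at hi
    obtain ⟨j, hj⟩ := hi
    refine le_trans ?_ (single_le_sum hnonneg (mem_univ j))
    rw [← one_div, le_div_iff₀ (lt_of_le_of_ne (hA i j) hj.symm)]
    exact mul_le_one_of_mem_polyQ hA hx.1 i j

theorem isExtreme_polyQFace {n q : ℕ} (A : Matrix (Fin n) (Fin q) ℝ) :
    IsExtreme ℝ (polyQ A) (polyQFace A) := by
  refine ⟨fun x hx => hx.1, fun y hy z hz x hx hseg => ⟨hy, fun i hi => ?_⟩⟩
  obtain ⟨s, t, hs, ht, -, rfl⟩ := hseg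
  have h := hx.2 i hi
  simp only [Pi.add_apply, Pi.smul_apply, smul_eq_mul] at h
  nlinarith [hy.1 i, mul_nonneg hs.le (hy.1 i), mul_nonneg ht.le (hz.1 i)]

/-- A linear objective supported on the nonzero rows of `A` is bounded on `polyQ A` by its
values at the extreme points. -/
theorem sum_mul_le_of_extremePoints {n q : ℕ} {A : Matrix (Fin n) (Fin q) ℝ}
    (hA : ∀ i j, 0 ≤ A i j) {c : Fin n → ℝ} (hc : ∀ i, (∀ j, A i j = 0) → c i = 0) {b : ℝ}
    (h : ∀ x ∈ Set.extremePoints ℝ (polyQ A), ∑ i, x i * c i ≤ b) :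
    ∀ x ∈ polyQ A, ∑ i, x i * c i ≤ b := by
  classical
  intro x hx
  let x' : Fin n → ℝ := fun i => if ∀ j, A i j = 0 then 0 else x i
  have hx' : x' ∈ polyQFace A := by
    refine ⟨⟨fun i => ?_, fun j => le_trans (le_of_eq ?_) (hx.2 j)⟩, fun i hi => if_pos hi⟩
    · simp only [x']
      split_ifs
      exacts [le_rfl, hx.1 i]
    · refine sum_congr rfl fun i _ => ?_
      simp only [x']
      split_ifs with hi
      · simp [hi j]
      · rfl
  have hxc : ∑ i, x i * c i = ∑ i, x' i * c i := by
    refine sum_congr rfl fun i _ => ?_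
    simp only [x']
    split_ifs with hi
    · simp [hc i hi]
    · rfl
  let l : StrongDual ℝ (Fin n → ℝ) :=
    ∑ i, c i • ContinuousLinearMap.proj (R := ℝ) (φ := fun _ : Fin n => ℝ) i
  have hl : ∀ y, l y = ∑ i, y i * c i := fun y => by
    simp [l, mul_comm]
  have hexp : IsExposed ℝ (polyQFace A) (l.toExposed (polyQFace A)) :=
    ContinuousLinearMap.toExposed.isExposed
  have hcomp := isCompact_polyQFace hA
  obtain ⟨m, hm, hmax⟩ := hcomp.exists_isMaxOn ⟨x', hx'⟩ l.continuous.continuousOn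
  obtain ⟨e, he⟩ := (hexp.isCompact hcomp).extremePoints_nonempty ⟨m, hm, fun y hy => hmax hy⟩
  have heQ := ((isExtreme_polyQFace A).trans hexp.isExtreme).extremePoints_subset_extremePoints he
  have hle := he.1.2 x' hx'
  rw [hl, hl] at hle
  rw [hxc]
  exact hle.trans (h e heQ)

open Pointwise in
/-- Linear programming duality for `max {⟨x, c⟩ : x ≥ 0, xA ≤ 𝟙}`. -/
theorem exists_dual_of_sum_mul_le {n q : ℕ} [Nonempty (Fin q)] {A : Matrix (Fin n) (Fin q) ℝ}
    (hA : ∀ i j, 0 ≤ A i j) {b : ℝ} (hb : 0 ≤ b) {c : Fin n → ℝ}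
    (h : ∀ x ∈ polyQ A, ∑ i, x i * c i ≤ b) :
    ∃ μ : Fin q → ℝ, (∀ j, 0 ≤ μ j) ∧ ∑ j, μ j = b ∧ ∀ i, c i ≤ ∑ j, μ j * A i j := by
  classical
  let L : (Fin q → ℝ) →ₗ[ℝ] (Fin n → ℝ) := b • A.mulVecLin
  have hL : ∀ μ i, L μ i = b * ∑ j, A i j * μ j := fun μ i => by
    simp [L, Matrix.mulVec, dotProduct]
  let D : Set (Fin n → ℝ) := L '' stdSimplex ℝ (Fin q) + Set.Iic (0 : Fin n → ℝ)
  have hDclosed : IsClosed D :=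
    isClosed_Iic.add_left_of_isCompact
      ((isCompact_stdSimplex ℝ (Fin q)).image L.continuous_of_finiteDimensional)
  have hDconv : Convex ℝ D := ((convex_stdSimplex ℝ (Fin q)).linear_image L).add (convex_Iic 0)
  by_cases hcD : c ∈ D
  · obtain ⟨_, ⟨μ, hμ, rfl⟩, z, hz, rfl⟩ := hcD
    refine ⟨fun j => b * μ j, fun j => mul_nonneg hb (hμ.1 j), ?_, fun i => ?_⟩
    · rw [← mul_sum, hμ.2, mul_one]
    · have hzi : z i ≤ 0 := hz i
      have : ∑ j, b * μ j * A i j = L μ i := by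
        rw [hL, mul_sum]
        exact sum_congr rfl fun j _ => by ring
      simp only [Pi.add_apply]
      linarith
  exfalso
  obtain ⟨f, u, hfD, hfc⟩ := geometric_hahn_banach_closed_point hDconv hDclosed hcD
  let w : Fin n → ℝ := fun i => f (Pi.single i 1)
  have hf : ∀ y, f y = ∑ i, w i * y i := fun y => by
    conv_lhs => rw [pi_eq_sum_univ' y]
    simp [w, map_sum, mul_comm]
  have hcol : ∀ k, ∀ z ≤ (0 : Fin n → ℝ), b * ∑ i, w i * A i k + f z < u := fun k z hz => by
    have hmem : L (Pi.single k 1) + z ∈ D :=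
      Set.add_mem_add ⟨_, single_mem_stdSimplex ℝ k, rfl⟩ hz
    have hlt := hfD _ hmem
    have hfL : f (L (Pi.single k 1)) = b * ∑ i, w i * A i k := by
      rw [hf, mul_sum]
      refine sum_congr rfl fun i _ => ?_
      rw [hL]
      simp [Pi.single_apply]
      ring
    rwa [map_add, hfL] at hlt
  obtain ⟨k₀⟩ := ‹Nonempty (Fin q)›
  have hw : ∀ i, 0 ≤ w i := by
    intro i
    by_contra hneg
    push Not at hneg
    obtain ⟨m, hm⟩ := exists_nat_gt ((u - b * ∑ i, w i * A i k₀) / (-w i))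
    rw [div_lt_iff₀ (by linarith)] at hm
    have hz : -((m : ℝ) • (Pi.single i 1 : Fin n → ℝ)) ≤ 0 := by
      rw [neg_nonpos]
      exact smul_nonneg (Nat.cast_nonneg m) (Pi.single_nonneg.2 zero_le_one)
    have hlt := hcol k₀ _ hz
    rw [map_neg, map_smul, smul_eq_mul] at hlt
    change _ + -(↑m * w i) < u at hlt
    linarith
  have hwA : ∀ k, 0 ≤ ∑ i, w i * A i k := fun k =>
    sum_nonneg fun i _ => mul_nonneg (hw i) (hA i k)
  have hcol' : ∀ k, b * ∑ i, w i * A i k < u := fun k => by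
    simpa using hcol k 0 le_rfl
  have hu : 0 < u := (mul_nonneg hb (hwA k₀)).trans_lt (hcol' k₀)
  have hscale : ∀ t : ℝ, 0 ≤ t → (∀ k, t * ∑ i, w i * A i k ≤ 1) → t * f c ≤ b := by
    intro t ht hle
    have hmem : (fun i => t * w i) ∈ polyQ A := by
      refine ⟨fun i => mul_nonneg ht (hw i), fun k => ?_⟩
      simpa only [mul_sum, mul_assoc] using hle k
    simpa only [hf, mul_sum, mul_assoc] using h _ hmem
  rcases hb.eq_or_lt with rfl | hbpos
  · have hS : 0 ≤ ∑ k, ∑ i, w i * A i k := sum_nonneg fun k _ => hwA k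
    have hpos : 0 < 1 + ∑ k, ∑ i, w i * A i k := by linarith
    have hle := hscale (1 + ∑ k, ∑ i, w i * A i k)⁻¹ (inv_nonneg.2 hpos.le) fun k => by
      rw [inv_mul_le_iff₀ hpos]
      have := single_le_sum (f := fun k => ∑ i, w i * A i k) (fun k _ => hwA k) (mem_univ k)
      linarith
    have := mul_pos (inv_pos.2 hpos) (hu.trans hfc)
    linarith
  · have hle := hscale (b / u) (by positivity) fun k => by
      rw [div_mul_eq_mul_div, div_le_one hu]
      exact (hcol' k).le
    rw [div_mul_eq_mul_div, div_le_iff₀ hu] at hle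
    exact absurd (le_of_mul_le_mul_left hle hbpos) (not_le.2 hfc)

/-- A lattice point of the `(b + 1)`-st dilation of the convex hull of the columns, written with
positive weight on column `j`, stays in the `b`-th dilation after subtracting column `j`. -/
theorem exists_weights_sub_column {n q : ℕ} (A : Matrix (Fin n) (Fin q) ℕ)
    (hperfect : IsIntegralPoly (polyQ (fun i j => (A i j : ℝ))))
    (x0 : Fin n → ℝ) (hx0pos : ∀ i, 0 < x0 i)
    (hx0 : ∀ j, ∑ i, (A i j : ℝ) * x0 i = 1) (b : ℕ) (a : Fin n → ℤ) (lam : Fin q → ℝ)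
    (hlam : ∀ j, 0 ≤ lam j) (hsum : ∑ j, lam j = (b : ℝ) + 1)
    (ha : ∀ i, (a i : ℝ) = ∑ j, lam j * (A i j : ℝ)) (j : Fin q) (hj : 0 < lam j) :
    ∃ μ : Fin q → ℝ, (∀ k, 0 ≤ μ k) ∧ ∑ k, μ k = (b : ℝ) ∧
      ∀ i, ((a i - A i j : ℤ) : ℝ) = ∑ k, μ k * (A i k : ℝ) := by
  have : Nonempty (Fin q) := ⟨j⟩
  have hA : ∀ i k, (0 : ℝ) ≤ (A i k : ℝ) := fun i k => Nat.cast_nonneg _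
  have hpair : ∀ (x : Fin n → ℝ) (ν : Fin q → ℝ),
      ∑ i, x i * ∑ k, ν k * (A i k : ℝ) = ∑ k, ν k * ∑ i, x i * (A i k : ℝ) := fun x ν => by
    simp only [mul_sum]
    rw [sum_comm]
    exact sum_congr rfl fun k _ => sum_congr rfl fun i _ => by ring
  have hx0' : ∀ k, ∑ i, x0 i * (A i k : ℝ) = 1 := fun k => by
    simpa only [mul_comm] using hx0 k
  have hsub : ∀ x : Fin n → ℝ, ∑ i, x i * ((a i - A i j : ℤ) : ℝ)
      = ∑ k, lam k * ∑ i, x i * (A i k : ℝ) - ∑ i, x i * (A i j : ℝ) := fun x => by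
    rw [← hpair, ← sum_sub_distrib]
    refine sum_congr rfl fun i _ => ?_
    push_cast
    rw [← ha]
    ring
  have hext : ∀ x ∈ Set.extremePoints ℝ (polyQ fun i j => (A i j : ℝ)),
      ∑ i, x i * ((a i - A i j : ℤ) : ℝ) ≤ b := by
    intro x hx
    choose m hm using hperfect x hx
    have hle := hx.1.2
    have hnn : 0 ≤ ∑ i, x i * (A i j : ℝ) :=
      sum_nonneg fun i _ => mul_nonneg (hx.1.1 i) (hA i j)
    have hslack : lam j * (1 - ∑ i, x i * (A i j : ℝ)) ≤
        (b : ℝ) + 1 - ∑ k, lam k * ∑ i, x i * (A i k : ℝ) := by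
      have h1 := single_le_sum (f := fun k => lam k * (1 - ∑ i, x i * (A i k : ℝ)))
        (fun k _ => mul_nonneg (hlam k) (sub_nonneg.2 (hle k))) (mem_univ j)
      simpa only [mul_sub, mul_one, sum_sub_distrib, hsum] using h1
    have hlt : ∑ i, x i * ((a i - A i j : ℤ) : ℝ) < (b : ℝ) + 1 := by
      rw [hsub]
      rcases hnn.eq_or_lt with h0 | hpos
      · rw [← h0] at hslack ⊢
        linarith
      · have := mul_nonneg hj.le (sub_nonneg.2 (hle j))
        linarith
    have hint : ∑ i, x i * ((a i - A i j : ℤ) : ℝ) = ((∑ i, m i * (a i - A i j) : ℤ) : ℝ) := by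
      rw [Int.cast_sum]
      exact sum_congr rfl fun i _ => by rw [hm, Int.cast_mul]
    rw [hint] at hlt ⊢
    have : ∑ i, m i * (a i - A i j) < (b : ℤ) + 1 := by exact_mod_cast hlt
    exact_mod_cast Int.lt_add_one_iff.1 this
  have hzero : ∀ i, (∀ k, (A i k : ℝ) = 0) → ((a i - A i j : ℤ) : ℝ) = 0 := fun i hi => by
    push_cast
    rw [ha]
    simp [hi]
  obtain ⟨μ, hμ, hμsum, hμle⟩ := exists_dual_of_sum_mul_le hA (Nat.cast_nonneg b)
    (sum_mul_le_of_extremePoints hA hzero hext)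
  refine ⟨μ, hμ, hμsum, fun i => ?_⟩
  have htotal : ∑ i, x0 i * (∑ k, μ k * (A i k : ℝ) - ((a i - A i j : ℤ) : ℝ)) = 0 := by
    simp only [mul_sub, sum_sub_distrib]
    rw [hpair, hsub]
    simp only [hx0', mul_one, hμsum, hsum]
    ring
  have hi := (sum_eq_zero_iff_of_nonneg fun i _ =>
    mul_nonneg (hx0pos i).le (sub_nonneg.2 (hμle i))).1 htotal i (mem_univ i)
  have := (mul_eq_zero.1 hi).resolve_left (hx0pos i).ne'
  linarith

/-- Let `A` be a perfect `{0,1}`-matrix of size `n × q` (the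
incidence matrix of a clutter, i.e. the supports of the columns are
incomparable, such that the polytope `{x : x ≥ 0, xA ≤ 𝟙}` is integral) with
columns `v_1,…,v_q`, and suppose there is `x_0 ∈ ℝ^n` with all entries
positive and `⟨v_i, x_0⟩ = 1` for all `i`. Then the Ehrhart ring of
`P = conv(v_1,…,v_q)` equals `K[x^{v_1}t,…,x^{v_q}t]`: for every `b ∈ ℕ` and
every lattice point `a ∈ bP ∩ ℤ^n` there are `η_1,…,η_q ∈ ℕ` with
`∑ η_j = b` and `a = ∑ η_j v_j`. -/
theorem ehrhart_eq_monomial_subring {n q : ℕ} (A : Matrix (Fin n) (Fin q) ℕ)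
    (h01 : ∀ i j, A i j ≤ 1)
    (hclutter : ∀ j j' : Fin q, (∀ i, A i j = 1 → A i j' = 1) → j = j')
    (hperfect : IsIntegralPoly (polyQ (fun i j => (A i j : ℝ))))
    (x0 : Fin n → ℝ) (hx0pos : ∀ i, 0 < x0 i)
    (hx0 : ∀ j, ∑ i, (A i j : ℝ) * x0 i = 1) :
    ∀ (b : ℕ) (a : Fin n → ℤ),
      (∃ lam : Fin q → ℝ, (∀ j, 0 ≤ lam j) ∧ (∑ j, lam j) = (b : ℝ) ∧
        ∀ i, (a i : ℝ) = ∑ j, lam j * (A i j : ℝ)) →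
      ∃ η : Fin q → ℕ, (∑ j, η j) = b ∧ ∀ i, a i = ∑ j, (η j : ℤ) * (A i j : ℤ) := by
  intro b
  induction b with
  | zero =>
    rintro a ⟨lam, hlam, hsum, ha⟩
    rw [Nat.cast_zero, sum_eq_zero_iff_of_nonneg fun j _ => hlam j] at hsum
    refine ⟨0, by simp, fun i => ?_⟩
    have hai : (a i : ℝ) = 0 := by
      rw [ha]
      exact sum_eq_zero fun j hj => by rw [hsum j hj, zero_mul]
    simpa using hai
  | succ b ih =>
    rintro a ⟨lam, hlam, hsum, ha⟩
    rw [Nat.cast_succ] at hsum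
    obtain ⟨j, -, hj⟩ : ∃ j ∈ univ, 0 < lam j := by
      refine exists_lt_of_sum_lt (f := fun _ => (0 : ℝ)) ?_
      rw [hsum, sum_const_zero]
      positivity
    obtain ⟨η, hη, hηa⟩ := ih (fun i => a i - A i j)
      (exists_weights_sub_column A hperfect x0 hx0pos hx0 b a lam hlam hsum ha j hj)
    refine ⟨η + Pi.single j 1, ?_, fun i => ?_⟩
    · simp [sum_add_distrib, hη]
    · have hi := hηa i
      simp only [Pi.add_apply, Nat.cast_add, add_mul, sum_add_distrib, ← hi]
      simp [Pi.single_apply]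
end
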